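/- Let k be an algebraically closed field of characteristic zero and d ≥ 1. Set t = ⌊C(d+4,4)/(d+1)⌋ and t* = ⌈C(d+4,4)/(d+1)⌉; note t ≥ 2(d−1). Then there exist in P^4 sundials Ĉ_1,…,Ĉ_{d−1} and lines M_1,…,M_{t−2(d−1)} whose combined ideal I satisfies dim (I)_d = C(d+4,4) − t(d+1); and there exist sundials Ĉ_1,…,Ĉ_{d−1} and lines M_1,…,M_{t*−2(d−1)} whose combined ideal I* satisfies dim (I*)_d = 0. -/

import Mathlib

open MvPolynomial

noncomputable def vanIdeal (k : Type) [Field k] (N : ℕ) (V : Set (Fin N → k)) :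
    Ideal (MvPolynomial (Fin N) k) where
  carrier := {f | ∀ v ∈ V, MvPolynomial.eval v f = 0}
  add_mem' := by
    intro f g hf hg v hv
    simp only [Set.mem_setOf_eq] at *
    simp [map_add, hf v hv, hg v hv]
  zero_mem' := by
    intro v hv
    simp
  smul_mem' := by
    intro c f hf v hv
    simp only [Set.mem_setOf_eq] at *
    simp [smul_eq_mul, hf v hv]

noncomputable def hdim (k : Type) [Field k] (N : ℕ)
    (I : Ideal (MvPolynomial (Fin N) k)) (d : ℕ) : ℕ :=
  Module.finrank k
    ↥(Submodule.restrictScalars k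
        (I : Submodule (MvPolynomial (Fin N) k) (MvPolynomial (Fin N) k))
      ⊓ MvPolynomial.homogeneousSubmodule (Fin N) k d)

/-- A 3-dimensional sundial: two distinct lines `V₁ ≠ V₂` meeting in a point
`P = V₁ ⊓ V₂`, together with a 4-dimensional subspace `T ⊇ V₁ ⊔ V₂`. -/
def IsSundial (k : Type) [Field k] (N : ℕ)
    (V₁ V₂ T : Submodule k (Fin N → k)) : Prop :=
  Module.finrank k V₁ = 2 ∧ Module.finrank k V₂ = 2 ∧ V₁ ≠ V₂ ∧
    Module.finrank k ↥(V₁ ⊓ V₂) = 1 ∧ V₁ ⊔ V₂ ≤ T ∧ Module.finrank k T = 4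

/-- The ideal `I(V₁) ∩ I(V₂) ∩ (I(P)² + I(T))` of a 3-dimensional sundial. -/
noncomputable def sundialIdeal (k : Type) [Field k] (N : ℕ)
    (V₁ V₂ T : Submodule k (Fin N → k)) : Ideal (MvPolynomial (Fin N) k) :=
  vanIdeal k N ↑V₁ ⊓ vanIdeal k N ↑V₂ ⊓
    ((vanIdeal k N ↑(V₁ ⊓ V₂)) ^ 2 + vanIdeal k N ↑T)


section LinAlg
variable {k : Type} [Field k]

/-- Exact-sequence bound. -/
lemma finrank_split {V V' B : Type*} [AddCommGroup V] [Module k V] [AddCommGroup V'] [Module k V']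
    [AddCommGroup B] [Module k B] (K : Submodule k V) (K' : Submodule k V')
    [FiniteDimensional k K] [FiniteDimensional k K']
    (tr : V →ₗ[k] B) (μ : V' →ₗ[k] V) (h : K ⊓ LinearMap.ker tr ≤ K'.map μ) :
    Module.finrank k K ≤ Module.finrank k K' + Module.finrank k (K.map tr) := by
  have h1 := LinearMap.finrank_range_add_finrank_ker (tr.domRestrict K)
  have h2 : Module.finrank k (LinearMap.ker (tr.domRestrict K)) ≤ Module.finrank k K' := by
    have h3 : Module.finrank k (LinearMap.ker (tr.domRestrict K)) =
        Module.finrank k (((LinearMap.ker (tr.domRestrict K)).map K.subtype)) :=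
      (LinearEquiv.finrank_eq (Submodule.equivMapOfInjective K.subtype K.injective_subtype _))
    rw [h3]
    have h4 : (LinearMap.ker (tr.domRestrict K)).map K.subtype ≤ K'.map μ := by
      refine le_trans ?_ h
      rintro x ⟨y, hy, rfl⟩
      refine ⟨y.2, ?_⟩
      simpa using hy
    calc _ ≤ Module.finrank k (K'.map μ) := Submodule.finrank_mono h4
      _ ≤ _ := Submodule.finrank_map_le μ K'
  have h5 : LinearMap.range (tr.domRestrict K) = K.map tr := LinearMap.range_domRestrict K tr
  rw [h5] at h1
  omega

lemma finrank_le_add_card {V : Type*} [AddCommGroup V] [Module k V] (W : Submodule k V)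
    [FiniteDimensional k W] {ι : Type*} [Fintype ι] (φ : ι → V →ₗ[k] k) :
    Module.finrank k W ≤ Module.finrank k (W ⊓ ⨅ i, LinearMap.ker (φ i) : Submodule k V)
      + Fintype.card ι := by
  have : FiniteDimensional k (W ⊓ ⨅ i, LinearMap.ker (φ i) : Submodule k V) :=
    Submodule.finiteDimensional_of_le inf_le_left
  have h := finrank_split W (W ⊓ ⨅ i, LinearMap.ker (φ i) : Submodule k V) (LinearMap.pi φ)
    (LinearMap.id) (by simp [LinearMap.ker_pi])
  have h2 : Module.finrank k (W.map (LinearMap.pi φ)) ≤ Fintype.card ι := by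
    have := Submodule.finrank_le (W.map (LinearMap.pi φ))
    simpa using this
  omega

lemma exists_points_fin {V : Type*} [AddCommGroup V] [Module k V] (W : Submodule k V)
    [FiniteDimensional k W] {J : Type*} [Nonempty J] (φ : J → V →ₗ[k] k)
    (h : W ⊓ ⨅ j, LinearMap.ker (φ j) = ⊥) (n : ℕ) :
    ∃ c : Fin n → J, Module.finrank k (W ⊓ ⨅ i, LinearMap.ker (φ (c i)) : Submodule k V)
      ≤ Module.finrank k W - n := by
  induction n with
  | zero => exact ⟨Fin.elim0, by simpa using Submodule.finrank_mono (inf_le_left)⟩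
  | succ n ih =>
    obtain ⟨c, hc⟩ := ih
    set W' := (W ⊓ ⨅ i, LinearMap.ker (φ (c i)) : Submodule k V) with hW'
    have : FiniteDimensional k W' := Submodule.finiteDimensional_of_le inf_le_left
    have key : ∃ j, Module.finrank k (W' ⊓ LinearMap.ker (φ j) : Submodule k V)
        ≤ Module.finrank k W' - 1 := by
      by_cases hb : W' = ⊥
      · exact ⟨Classical.arbitrary J, by rw [hb]; simp⟩
      · have : ∃ j, ¬ W' ≤ LinearMap.ker (φ j) := by
          by_contra hcon
          push Not at hcon
          apply hb
          rw [eq_bot_iff, ← h]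
          exact le_inf inf_le_left (le_iInf hcon)
        obtain ⟨j, hj⟩ := this
        refine ⟨j, ?_⟩
        have hlt : W' ⊓ LinearMap.ker (φ j) < W' := by
          refine lt_of_le_of_ne inf_le_left ?_
          intro he
          exact hj (by rw [← he]; exact inf_le_right)
        have := Submodule.finrank_lt_finrank_of_lt hlt
        omega
    obtain ⟨j, hj⟩ := key
    refine ⟨Fin.snoc c j, ?_⟩
    have he : (W ⊓ ⨅ i, LinearMap.ker (φ (Fin.snoc (α := fun _ => J) c j i)) : Submodule k V) ≤
        W' ⊓ LinearMap.ker (φ j) := by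
      refine le_inf (le_inf inf_le_left (le_iInf fun i => ?_)) ?_
      · refine inf_le_right.trans ((iInf_le _ i.castSucc).trans ?_)
        simp
      · refine inf_le_right.trans ((iInf_le _ (Fin.last n)).trans ?_)
        simp
    have h1 := Submodule.finrank_mono he
    omega

lemma exists_points {V : Type*} [AddCommGroup V] [Module k V] (W : Submodule k V)
    [FiniteDimensional k W] {J : Type*} [Nonempty J] (φ : J → V →ₗ[k] k)
    (h : W ⊓ ⨅ j, LinearMap.ker (φ j) = ⊥) (ι : Type*) [Fintype ι] :
    ∃ c : ι → J, Module.finrank k (W ⊓ ⨅ i, LinearMap.ker (φ (c i)) : Submodule k V)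
      ≤ Module.finrank k W - Fintype.card ι := by
  obtain ⟨c, hc⟩ := exists_points_fin W φ h (Fintype.card ι)
  refine ⟨fun i => c (Fintype.equivFin ι i), ?_⟩
  rwa [(Fintype.equivFin ι).iInf_comp (g := fun i => LinearMap.ker (φ (c i)))]

end LinAlg

section Open
variable {k : Type} [Field k]

/-- A function that is polynomial on each affine line. -/
def PolyFn {E : Type*} [AddCommGroup E] [Module k E] (f : E → k) : Prop :=
  ∀ x y : E, ∃ p : Polynomial k, ∀ c : k, f (x + c • y) = p.eval c

/-- A predicate that is Zariski-open on each affine line. -/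
def Op (k : Type) [Field k] {E : Type*} [AddCommGroup E] [Module k E] (A : E → Prop) : Prop :=
  ∀ x y : E, A x → ∀ᶠ c in (Filter.cofinite : Filter k), A (x + c • y)

variable {E E' : Type*} [AddCommGroup E] [Module k E] [AddCommGroup E'] [Module k E']

lemma PolyFn.const (a : k) : PolyFn (fun _ : E => a) := fun _ _ => ⟨Polynomial.C a, by simp⟩

lemma PolyFn.add {f g : E → k} (hf : PolyFn f) (hg : PolyFn g) : PolyFn (fun x => f x + g x) := by
  intro x y
  obtain ⟨p, hp⟩ := hf x y
  obtain ⟨q, hq⟩ := hg x y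
  exact ⟨p + q, by simp [hp, hq]⟩

lemma PolyFn.mul {f g : E → k} (hf : PolyFn f) (hg : PolyFn g) : PolyFn (fun x => f x * g x) := by
  intro x y
  obtain ⟨p, hp⟩ := hf x y
  obtain ⟨q, hq⟩ := hg x y
  exact ⟨p * q, by simp [hp, hq]⟩

lemma PolyFn.sub {f g : E → k} (hf : PolyFn f) (hg : PolyFn g) : PolyFn (fun x => f x - g x) := by
  intro x y
  obtain ⟨p, hp⟩ := hf x y
  obtain ⟨q, hq⟩ := hg x y
  exact ⟨p - q, by simp [hp, hq]⟩

lemma PolyFn.sum {ι : Type*} (s : Finset ι) {f : ι → E → k} (hf : ∀ i ∈ s, PolyFn (f i)) :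
    PolyFn (fun x => ∑ i ∈ s, f i x) := by
  classical
  induction s using Finset.induction_on with
  | empty => simpa using PolyFn.const 0
  | insert a s ha ih =>
    simp only [Finset.sum_insert ha]
    exact (hf a (by simp)).add (ih fun i hi => hf i (by simp [hi]))

lemma PolyFn.linear (L : E →ₗ[k] k) : PolyFn (fun x => L x) := fun x y =>
  ⟨Polynomial.C (L x) + Polynomial.C (L y) * Polynomial.X, fun c => by
    beta_reduce
    rw [map_add, map_smul, smul_eq_mul, Polynomial.eval_add, Polynomial.eval_mul,
      Polynomial.eval_C, Polynomial.eval_C, Polynomial.eval_X, mul_comm]⟩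

lemma PolyFn.pow {f : E → k} (hf : PolyFn f) (n : ℕ) : PolyFn (fun x => f x ^ n) := by
  intro x y
  obtain ⟨p, hp⟩ := hf x y
  exact ⟨p ^ n, by simp [hp]⟩

lemma Op.ne_zero [Infinite k] {f : E → k} (hf : PolyFn f) : Op k (fun x => f x ≠ 0) := by
  intro x y h0
  obtain ⟨p, hp⟩ := hf x y
  have hp0 : p ≠ 0 := by
    rintro rfl
    have := hp 0
    simp at this
    exact h0 this
  have : (({c | p.IsRoot c} : Set k)).Finite := Polynomial.finite_setOfPred_isRoot hp0
  rw [Filter.eventually_cofinite]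
  refine this.subset ?_
  intro c hc
  simp only [Set.mem_ofPred_eq, not_not] at hc ⊢
  rw [hp] at hc
  exact hc

lemma Op.and {A B : E → Prop} (hA : Op k A) (hB : Op k B) : Op k (fun x => A x ∧ B x) :=
  fun x y h => (hA x y h.1).and (hB x y h.2)

lemma Op.all {ι : Type*} [Finite ι] {A : ι → E → Prop} (hA : ∀ i, Op k (A i)) :
    Op k (fun x => ∀ i, A i x) := by
  intro x y h
  rw [Filter.eventually_all]
  exact fun i => hA i x y (h i)

lemma Op.comp {A : E' → Prop} (hA : Op k A) (L : E →ₗ[k] E') : Op k (fun x => A (L x)) := by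
  intro x y h
  have := hA (L x) (L y) h
  simpa using this

lemma PolyFn.comp {f : E' → k} (hf : PolyFn f) (L : E →ₗ[k] E') : PolyFn (fun x => f (L x)) := by
  intro x y
  obtain ⟨p, hp⟩ := hf (L x) (L y)
  exact ⟨p, fun c => by simpa using hp c⟩

lemma Op.exists_and [Infinite k] {A B : E → Prop} (hA : Op k A) (hB : Op k B)
    (a : ∃ x, A x) (b : ∃ x, B x) : ∃ x, A x ∧ B x := by
  obtain ⟨x, hx⟩ := a
  obtain ⟨y, hy⟩ := b
  have h1 := hA x (y - x) hx
  have h2 := hB y (x - y) hy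
  have ht : Filter.Tendsto (fun c : k => 1 - c) Filter.cofinite Filter.cofinite :=
    (sub_right_injective).tendsto_cofinite
  have h3 := ht.eventually h2
  obtain ⟨c, hc1, hc2⟩ := (h1.and h3).exists
  refine ⟨_, hc1, ?_⟩
  convert hc2 using 1
  module

/-- families of subspaces cut out by polynomially varying functionals -/
def AlgFam {V : Type*} [AddCommGroup V] [Module k V] (K : E → Submodule k V) : Prop :=
  ∃ (J : Type) (φ : J → E → V →ₗ[k] k), (∀ j F, PolyFn (fun x => φ j x F)) ∧
    ∀ x, K x = ⨅ j, LinearMap.ker (φ j x)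

variable {V : Type*} [AddCommGroup V] [Module k V]

lemma AlgFam.single (φ : E → V →ₗ[k] k) (h : ∀ F, PolyFn (fun x => φ x F)) :
    AlgFam (fun x => LinearMap.ker (φ x)) :=
  ⟨Unit, fun _ => φ, fun _ => h, fun x => by simp⟩

lemma AlgFam.inf {K K' : E → Submodule k V} (h : AlgFam K) (h' : AlgFam K') :
    AlgFam (fun x => K x ⊓ K' x) := by
  obtain ⟨J, φ, hφ, hK⟩ := h
  obtain ⟨J', φ', hφ', hK'⟩ := h'
  refine ⟨J ⊕ J', Sum.elim φ φ', ?_, ?_⟩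
  · rintro (j | j) F
    · exact hφ j F
    · exact hφ' j F
  · intro x
    simp [iInf_sum, hK, hK']

lemma AlgFam.iInf {ι : Type} {K : ι → E → Submodule k V} (h : ∀ i, AlgFam (K i)) :
    AlgFam (fun x => ⨅ i, K i x) := by
  choose J φ hφ hK using h
  refine ⟨Σ i, J i, fun j => φ j.1 j.2, fun j F => hφ j.1 j.2 F, fun x => ?_⟩
  simp [iInf_sigma, hK]

lemma AlgFam.comp {K : E' → Submodule k V} (h : AlgFam K) (L : E →ₗ[k] E') :
    AlgFam (fun x => K (L x)) := by
  obtain ⟨J, φ, hφ, hK⟩ := h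
  exact ⟨J, fun j x => φ j (L x), fun j F => (hφ j F).comp L, fun x => hK _⟩

lemma PolyFn.prod {ι : Type*} (s : Finset ι) {f : ι → E → k} (hf : ∀ i ∈ s, PolyFn (f i)) :
    PolyFn (fun x => ∏ i ∈ s, f i x) := by
  classical
  induction s using Finset.induction_on with
  | empty => simpa using PolyFn.const 1
  | insert a s ha ih =>
    simp only [Finset.prod_insert ha]
    exact (hf a (by simp)).mul (ih fun i hi => hf i (by simp [hi]))

lemma PolyFn.det {n : ℕ} {M : E → Matrix (Fin n) (Fin n) k}
    (h : ∀ i j, PolyFn (fun x => M x i j)) : PolyFn (fun x => (M x).det) := by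
  simp only [Matrix.det_apply']
  exact PolyFn.sum _ fun σ _ => (PolyFn.const _).mul (PolyFn.prod _ fun i _ => h _ _)

lemma op_ker_zero [Infinite k] [FiniteDimensional k V] {K : E → Submodule k V} (h : AlgFam K) :
    Op k (fun x => K x = ⊥) := by
  obtain ⟨J, φ, hφ, hK⟩ := h
  intro x y h0
  simp only [hK] at h0 ⊢
  rcases isEmpty_or_nonempty J with hJ | hJ
  · simp only [iInf_of_empty] at h0 ⊢
    exact Filter.Eventually.of_forall fun _ => h0
  obtain ⟨c, hc⟩ := exists_points_fin (⊤ : Submodule k V) (fun j => φ j x) (by simpa using h0)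
    (Module.finrank k V)
  set b := Module.finBasis k V
  let M : E → Matrix (Fin (Module.finrank k V)) (Fin (Module.finrank k V)) k :=
    fun z => Matrix.of fun i j => φ (c i) z (b j)
  have hmul : ∀ z v i, (M z).mulVec v i = φ (c i) z (b.equivFun.symm v) := by
    intro z v i
    simp [M, Matrix.mulVec, dotProduct, Module.Basis.equivFun_symm_apply, mul_comm]
  have hdet : Op k (fun z => (M z).det ≠ 0) := Op.ne_zero (PolyFn.det fun i j => hφ _ _)
  have hx : (M x).det ≠ 0 := by
    intro hd
    obtain ⟨v, hv, hv0⟩ := Matrix.exists_mulVec_eq_zero_iff.2 hd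
    rw [finrank_top, Nat.sub_self, Nat.le_zero, Submodule.finrank_eq_zero] at hc
    apply hv
    have : b.equivFun.symm v ∈ (⊤ ⊓ ⨅ i, LinearMap.ker (φ (c i) x) : Submodule k V) := by
      simp only [top_inf_eq, Submodule.mem_iInf, LinearMap.mem_ker]
      intro i
      rw [← hmul, hv0]; rfl
    rw [hc, Submodule.mem_bot] at this
    exact (LinearEquiv.map_eq_zero_iff _).1 this
  filter_upwards [hdet x y hx] with t ht
  rw [eq_bot_iff]
  intro F hF
  simp only [Submodule.mem_iInf, LinearMap.mem_ker] at hF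
  by_contra hne
  apply ht
  refine Matrix.exists_mulVec_eq_zero_iff.1 ⟨b.equivFun F, ?_, ?_⟩
  · simpa using hne
  · ext i
    rw [hmul]
    simpa using hF (c i)

lemma op_ker_aux [Infinite k] [FiniteDimensional k V] {K : E → Submodule k V} (h : AlgFam K)
    (m : ℕ) : Op k (fun x => Module.finrank k (K x) ≤ m) := by
  intro x y hx
  obtain ⟨c, hc⟩ := exists_points_fin (K x) (J := V →ₗ[k] k) (fun j => j) (by
    rw [eq_bot_iff]
    intro v hv
    simp only [Submodule.mem_inf, Submodule.mem_iInf, LinearMap.mem_ker] at hv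
    exact (Module.forall_dual_apply_eq_zero_iff k v).1 hv.2) m
  have h1 : AlgFam (fun z => K z ⊓ ⨅ i, LinearMap.ker (c i)) :=
    h.inf (AlgFam.iInf fun i => AlgFam.single (fun _ => c i) fun F => PolyFn.const _)
  have h2 := op_ker_zero h1 x y (by
    beta_reduce
    rw [← Submodule.finrank_eq_zero (R := k)]; omega)
  filter_upwards [h2] with t ht
  have := finrank_le_add_card (K (x + t • y)) c
  rw [ht] at this
  simpa using this

lemma finrank_comap_inf (R K : Submodule k V) :
    Module.finrank k (K.comap R.subtype) = Module.finrank k (R ⊓ K : Submodule k V) := by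
  have := (LinearEquiv.finrank_eq
    (Submodule.equivMapOfInjective R.subtype R.injective_subtype (K.comap R.subtype)))
  rw [this, Submodule.map_comap_eq, Submodule.range_subtype]

lemma op_ker [Infinite k] (R : Submodule k V) [FiniteDimensional k R] {K : E → Submodule k V}
    (h : AlgFam K) (m : ℕ) : Op k (fun x => Module.finrank k (R ⊓ K x : Submodule k V) ≤ m) := by
  obtain ⟨J, φ, hφ, hK⟩ := h
  have h2 : AlgFam (fun x => (K x).comap R.subtype) := by
    refine ⟨J, fun j x => (φ j x).comp R.subtype, fun j F => hφ j F, fun x => ?_⟩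
    simp [hK, Submodule.comap_iInf, LinearMap.ker_comp]
  have := op_ker_aux h2 m
  simpa only [finrank_comap_inf] using this

end Open


section Fun
variable {k : Type} [Field k] {n : ℕ}
variable {E : Type*} [AddCommGroup E] [Module k E]

/-- evaluation functional -/
noncomputable def evL (p : Fin n → k) : MvPolynomial (Fin n) k →ₗ[k] k :=
  (aeval p : MvPolynomial (Fin n) k →ₐ[k] k).toLinearMap

lemma evL_apply (p : Fin n → k) (F) : evL p F = eval p F := by
  simp [evL, aeval_eq_eval]

/-- restriction to the parametrized line `P + X w` -/
noncomputable def lineP (P w : Fin n → k) : MvPolynomial (Fin n) k →ₐ[k] Polynomial k :=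
  aeval (fun i => Polynomial.C (P i) + Polynomial.C (w i) * Polynomial.X)

/-- directional derivative functional -/
noncomputable def dvL (P w : Fin n → k) : MvPolynomial (Fin n) k →ₗ[k] k :=
  (Polynomial.lcoeff k 1).comp (lineP P w).toLinearMap

lemma dvL_apply (P w : Fin n → k) (F) : dvL P w F = (lineP P w F).coeff 1 := rfl

lemma eval_lineP (P w : Fin n → k) (F) (c : k) : (lineP P w F).eval c = eval (P + c • w) F := by
  have : ((Polynomial.aeval c).comp (lineP P w) : MvPolynomial (Fin n) k →ₐ[k] k)
      = aeval (P + c • w) := by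
    ext i
    simp [lineP]
    ring
  have h := congrArg (fun f => f F) this
  simpa [aeval_eq_eval, Polynomial.coe_aeval_eq_eval] using h

lemma coeff_zero_lineP (P w : Fin n → k) (F) : (lineP P w F).coeff 0 = eval P F := by
  rw [Polynomial.coeff_zero_eq_eval_zero, eval_lineP]; simp

lemma dvL_mul (P w : Fin n → k) (F G) :
    dvL P w (F * G) = eval P F * dvL P w G + dvL P w F * eval P G := by
  simp only [dvL_apply, map_mul, Polynomial.mul_coeff_one, coeff_zero_lineP]

lemma dvL_X (P w : Fin n → k) (i) : dvL P w (X i) = w i := by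
  simp [dvL_apply, lineP, Polynomial.coeff_C]

lemma dvL_C (P w : Fin n → k) (a : k) : dvL P w (C a) = 0 := by
  simp [dvL_apply, lineP, Polynomial.coeff_C]

/-- linear version of `divX` -/
noncomputable def divXL (k : Type) [Field k] : Polynomial k →ₗ[k] Polynomial k where
  toFun := Polynomial.divX
  map_add' p q := Polynomial.divX_add
  map_smul' a p := by
    simp [Polynomial.smul_eq_C_mul, Polynomial.divX_C_mul]

lemma divXL_apply (p : Polynomial k) : divXL k p = p.divX := rfl

lemma polyFn_evL {p : E → Fin n → k} (hp : ∀ i, PolyFn (fun x => p x i)) (F) :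
    PolyFn (fun x => evL (p x) F) := by
  simp only [evL_apply]
  induction F using MvPolynomial.induction_on with
  | C a => simpa using PolyFn.const a
  | add f g hf hg => simpa using hf.add hg
  | mul_X f i hf => simpa using hf.mul (hp i)

lemma polyFn_dvL {p w : E → Fin n → k} (hp : ∀ i, PolyFn (fun x => p x i))
    (hw : ∀ i, PolyFn (fun x => w x i)) (F) :
    PolyFn (fun x => dvL (p x) (w x) F) := by
  induction F using MvPolynomial.induction_on with
  | C a => simpa [dvL_C] using PolyFn.const 0
  | add f g hf hg => simpa using hf.add hg
  | mul_X f i hf =>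
    have h1 := polyFn_evL hp f
    simp only [evL_apply] at h1
    simpa [dvL_mul, dvL_X] using (h1.mul (hw i)).add (hf.mul (hp i))

/-- polynomials vanishing on the line spanned by `u`, `v` -/
noncomputable def lineK (u v : Fin n → k) : Submodule k (MvPolynomial (Fin n) k) :=
  ⨅ ab : k × k, LinearMap.ker (evL (ab.1 • u + ab.2 • v))

lemma mem_lineK {u v : Fin n → k} {F} : F ∈ lineK u v ↔ ∀ a b : k, eval (a • u + b • v) F = 0 := by
  simp [lineK, Submodule.mem_iInf, evL_apply]

/-- sundial: vectors `P, Q₁, Q₂, w` -/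
noncomputable def sunK (S : Fin 4 → Fin n → k) : Submodule k (MvPolynomial (Fin n) k) :=
  lineK (S 0) (S 1) ⊓ lineK (S 0) (S 2) ⊓ LinearMap.ker (dvL (S 0) (S 3))

noncomputable def cfgK {ι κ : Type} (σ : ι → Fin 4 → Fin n → k) (l : κ → Fin 2 → Fin n → k) :
    Submodule k (MvPolynomial (Fin n) k) :=
  (⨅ i, sunK (σ i)) ⊓ ⨅ j, lineK (l j 0) (l j 1)

lemma algFam_ev {p : E → Fin n → k} (hp : ∀ i, PolyFn (fun x => p x i)) :
    AlgFam (fun x => LinearMap.ker (evL (p x))) := AlgFam.single _ (polyFn_evL hp)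

lemma algFam_dv {p w : E → Fin n → k} (hp : ∀ i, PolyFn (fun x => p x i))
    (hw : ∀ i, PolyFn (fun x => w x i)) :
    AlgFam (fun x => LinearMap.ker (dvL (p x) (w x))) := AlgFam.single _ (polyFn_dvL hp hw)

lemma algFam_line {u v : E → Fin n → k} (hu : ∀ i, PolyFn (fun x => u x i))
    (hv : ∀ i, PolyFn (fun x => v x i)) : AlgFam (fun x => lineK (u x) (v x)) := by
  refine AlgFam.iInf fun ab => algFam_ev fun i => ?_
  simpa using ((PolyFn.const ab.1).mul (hu i)).add ((PolyFn.const ab.2).mul (hv i))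

lemma algFam_sun {S : E → Fin 4 → Fin n → k} (hS : ∀ a i, PolyFn (fun x => S x a i)) :
    AlgFam (fun x => sunK (S x)) :=
  ((algFam_line (hS 0) (hS 1)).inf (algFam_line (hS 0) (hS 2))).inf (algFam_dv (hS 0) (hS 3))

lemma algFam_cfg {ι κ : Type} {σ : E → ι → Fin 4 → Fin n → k} {l : E → κ → Fin 2 → Fin n → k}
    (hS : ∀ j a i, PolyFn (fun x => σ x j a i)) (hl : ∀ j a i, PolyFn (fun x => l x j a i)) :
    AlgFam (fun x => cfgK (σ x) (l x)) :=
  (AlgFam.iInf fun j => algFam_sun (hS j)).inf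
    (AlgFam.iInf fun j => algFam_line (hl j 0) (hl j 1))

/-- degree `d` forms -/
noncomputable abbrev Rd (k : Type) [Field k] (n d : ℕ) : Submodule k (MvPolynomial (Fin n) k) :=
  homogeneousSubmodule (Fin n) k d

instance (d : ℕ) : FiniteDimensional k (Rd k n d) := by
  have := homogeneousSubmodule_fg (σ := Fin n) (R := k) d
  exact Module.Finite.iff_fg.2 this

/-- there is a configuration of `s` sundials and `l` lines whose degree `d` forms have
dimension at most `m` -/
def Cfg (k : Type) [Field k] (n s l d m : ℕ) : Prop :=
  ∃ (σ : Fin s → Fin 4 → Fin n → k) (L : Fin l → Fin 2 → Fin n → k),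
    Module.finrank k (Rd k n d ⊓ cfgK σ L : Submodule k (MvPolynomial (Fin n) k)) ≤ m

lemma cfgK_equiv {ι κ ι' κ' : Type} (σ : ι → Fin 4 → Fin n → k) (L : κ → Fin 2 → Fin n → k)
    (e : ι' ≃ ι) (f : κ' ≃ κ) : cfgK (σ ∘ e) (L ∘ f) = cfgK σ L := by
  simp only [cfgK, Function.comp]
  rw [e.iInf_comp (g := fun i => sunK (σ i)), f.iInf_comp (g := fun j => lineK (L j 0) (L j 1))]

lemma Cfg.of_types {ι κ : Type} [Fintype ι] [Fintype κ] {s l d m : ℕ} (hs : Fintype.card ι = s)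
    (hl : Fintype.card κ = l) (σ : ι → Fin 4 → Fin n → k) (L : κ → Fin 2 → Fin n → k)
    (h : Module.finrank k (Rd k n d ⊓ cfgK σ L : Submodule k (MvPolynomial (Fin n) k)) ≤ m) :
    Cfg k n s l d m :=
  ⟨σ ∘ (Fintype.equivFinOfCardEq hs).symm, L ∘ (Fintype.equivFinOfCardEq hl).symm, by
    rwa [cfgK_equiv]⟩

lemma Cfg.mono {s l d m s' l' m' : ℕ} (h : Cfg k n s l d m) (hs : s ≤ s') (hl : l ≤ l')
    (hm : m ≤ m') : Cfg k n s' l' d m' := by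
  obtain ⟨σ, L, h⟩ := h
  refine ⟨fun i => if h : i.1 < s then σ ⟨i, h⟩ else 0,
    fun i => if h : i.1 < l then L ⟨i, h⟩ else 0, le_trans (Submodule.finrank_mono ?_) (h.trans hm)⟩
  refine inf_le_inf_left _ (inf_le_inf (le_iInf fun i => ?_) (le_iInf fun i => ?_))
  · refine (iInf_le _ ⟨i.1, by omega⟩).trans ?_
    simp
  · refine (iInf_le _ ⟨i.1, by omega⟩).trans ?_
    simp

lemma Cfg.degenerate [Infinite k] {s l d m : ℕ} (h : Cfg k n (s + 1) l d m) :
    Cfg k n s (l + 2) d m := by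
  obtain ⟨σ, L, h⟩ := h
  set S := σ (Fin.last s) with hS
  -- the divided difference functional
  let δ : k → MvPolynomial (Fin n) k →ₗ[k] k := fun c =>
    ((Polynomial.leval c).comp (divXL k)).comp (lineP (S 0) (S 3)).toLinearMap
  have hδ : ∀ F, PolyFn (fun c : k => δ c F) := by
    intro F x y
    refine ⟨((lineP (S 0) (S 3) F).divX).comp (Polynomial.C x + Polynomial.C y * Polynomial.X),
      fun c => ?_⟩
    simp [δ, Polynomial.eval_comp, Polynomial.leval_apply, divXL_apply, mul_comm c]
  let K : k → Submodule k (MvPolynomial (Fin n) k) := fun c =>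
    cfgK (σ ∘ Fin.castSucc) L ⊓ (lineK (S 0) (S 1) ⊓ lineK (S 0 + c • S 3) (S 2)
      ⊓ LinearMap.ker (δ c))
  have hK : AlgFam K := by
    have e1 : AlgFam (fun _ : k => cfgK (σ ∘ Fin.castSucc) L) :=
      algFam_cfg (σ := fun _ => σ ∘ Fin.castSucc) (l := fun _ => L)
        (fun _ _ _ => PolyFn.const _) (fun _ _ _ => PolyFn.const _)
    have e2 : AlgFam (fun _ : k => lineK (S 0) (S 1)) :=
      algFam_line (u := fun _ => S 0) (v := fun _ => S 1)
        (fun _ => PolyFn.const _) (fun _ => PolyFn.const _)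
    have e3 : AlgFam (fun c : k => lineK (S 0 + c • S 3) (S 2)) :=
      algFam_line (u := fun c : k => S 0 + c • S 3) (v := fun _ => S 2)
        (fun i => by
          simpa using (PolyFn.const (S 0 i)).add
            ((PolyFn.linear (LinearMap.id : k →ₗ[k] k)).mul (PolyFn.const (S 3 i))))
        (fun _ => PolyFn.const _)
    exact e1.inf ((e2.inf e3).inf (AlgFam.single _ hδ))
  have h0 : Module.finrank k (Rd k n d ⊓ K 0 : Submodule k (MvPolynomial (Fin n) k)) ≤ m := by
    refine le_trans (Submodule.finrank_mono ?_) h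
    refine inf_le_inf_left _ ?_
    simp only [K, cfgK, zero_smul, add_zero]
    refine le_inf (le_iInf fun i => ?_) (inf_le_left.trans inf_le_right)
    refine Fin.lastCases ?_ (fun i => ?_) i
    · refine inf_le_right.trans ?_
      refine inf_le_inf_left _ ?_
      intro F hF
      simp only [LinearMap.mem_ker, dvL_apply] at hF ⊢
      simpa [δ, Polynomial.leval_apply, divXL_apply,
        ← Polynomial.coeff_zero_eq_eval_zero] using hF
    · exact (inf_le_left.trans inf_le_left).trans (iInf_le _ i)
  have h1 := op_ker (Rd k n d) hK m 0 1 h0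
  have h2 : ∀ᶠ c in (Filter.cofinite : Filter k), c ≠ 0 := by
    rw [Filter.eventually_cofinite]; simp
  obtain ⟨c, hc, hc0⟩ := (h1.and h2).exists
  have hcc : (0 : k) + c • (1 : k) = c := by simp
  rw [hcc] at hc
  refine Cfg.of_types (ι := Fin s) (κ := Fin l ⊕ Fin 2) (by simp) (by simp) (σ ∘ Fin.castSucc)
    (Sum.elim L ![![S 0, S 1], ![S 0 + c • S 3, S 2]]) (le_trans (Submodule.finrank_mono ?_) hc)
  refine inf_le_inf_left _ ?_
  intro F hF
  simp only [cfgK, iInf_sum, Submodule.mem_inf, Submodule.mem_iInf, Sum.elim_inl, Sum.elim_inr,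
    Fin.forall_fin_two] at hF
  simp only [K, cfgK, Submodule.mem_inf, Submodule.mem_iInf]
  obtain ⟨hF1, hF2, hF3, hF4⟩ := hF
  simp at hF3 hF4
  refine ⟨⟨hF1, hF2⟩, ⟨hF3, hF4⟩, ?_⟩
  have e1 : eval (S 0) F = 0 := by simpa using mem_lineK.1 hF3 1 0
  have e2 : eval (S 0 + c • S 3) F = 0 := by simpa using mem_lineK.1 hF4 1 0
  rw [← eval_lineP, ← Polynomial.X_mul_divX_add (lineP (S 0) (S 3) F), coeff_zero_lineP, e1] at e2
  simp [hc0] at e2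
  simpa [δ, Polynomial.leval_apply, divXL_apply] using e2

lemma Cfg.to_lines [Infinite k] {s l d m : ℕ} (h : Cfg k n s l d m) (s' : ℕ) (hs : s' ≤ s) :
    Cfg k n s' (l + 2 * (s - s')) d m := by
  obtain ⟨j, rfl⟩ := Nat.exists_eq_add_of_le hs
  clear hs
  induction j generalizing l with
  | zero => simpa using h
  | succ j ih =>
    have := ih (Cfg.degenerate (by simpa [add_assoc] using h))
    convert this using 1
    omega
end Fun


section Hom
variable {k : Type} [Field k] {n : ℕ}

lemma aeval_smul_hom {A : Type*} [CommRing A] [Algebra k A] {d : ℕ} {F : MvPolynomial (Fin n) k}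
    (hF : F ∈ Rd k n d) (c : A) (g : Fin n → A) :
    aeval (fun i => c * g i) F = c ^ d * aeval g F := by
  rw [aeval_def, aeval_def, eval₂_eq', eval₂_eq', Finset.mul_sum]
  refine Finset.sum_congr rfl fun m hm => ?_
  have h := hF (mem_support_iff.1 hm)
  have h2 : ∑ i, m i = d := by
    rw [← h, Finsupp.weight_apply, Finsupp.sum_fintype _ _ (by simp)]; simp
  simp only [mul_pow, Finset.prod_mul_distrib, Finset.prod_pow_eq_pow_sum, h2]
  ring

lemma eval_smul_hom {d : ℕ} {F : MvPolynomial (Fin n) k}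
    (hF : F ∈ Rd k n d) (c : k) (g : Fin n → k) :
    eval (c • g) F = c ^ d * eval g F := by
  have := aeval_smul_hom hF c g
  simp only [aeval_eq_eval] at this
  exact this

lemma aeval_sub_mem {A : Type*} [CommRing A] [Algebra k A] (I : Ideal A) (f g : Fin n → A)
    (h : ∀ i, f i - g i ∈ I) (F : MvPolynomial (Fin n) k) : aeval f F - aeval g F ∈ I := by
  rw [← Ideal.Quotient.eq_zero_iff_mem, map_sub, sub_eq_zero]
  have : ((Ideal.Quotient.mkₐ k I).comp (aeval f)) = ((Ideal.Quotient.mkₐ k I).comp (aeval g)) := by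
    ext i
    simp only [AlgHom.comp_apply, aeval_X, Ideal.Quotient.mkₐ_eq_mk]
    exact Ideal.Quotient.eq.2 (h i)
  exact congrArg (fun φ => φ F) this

lemma homComp_mul {e d : ℕ} {q G : MvPolynomial (Fin n) k} (hq : q ∈ Rd k n e) :
    homogeneousComponent (e + d) (q * G) = q * homogeneousComponent d G := by
  conv_lhs => rw [← sum_homogeneousComponent G, Finset.mul_sum, map_sum]
  have : ∀ i, homogeneousComponent (e + d) (q * homogeneousComponent i G) =
      if i = d then q * homogeneousComponent d G else 0 := by
    intro i
    have h1 : q * homogeneousComponent i G ∈ homogeneousSubmodule (Fin n) k (e + i) :=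
      IsHomogeneous.mul hq (homogeneousComponent_isHomogeneous i G)
    rw [homogeneousComponent_of_mem h1]
    by_cases h : i = d
    · simp [h]
    · simp [h, Ne.symm h]
  simp only [this, Finset.sum_ite_eq', Finset.mem_range]
  split_ifs with h
  · rfl
  · rw [homogeneousComponent_eq_zero, mul_zero]; omega

lemma homComp_mul_lt {e d : ℕ} (hd : d < e) {q G : MvPolynomial (Fin n) k} (hq : q ∈ Rd k n e) :
    homogeneousComponent d (q * G) = 0 := by
  conv_lhs => rw [← sum_homogeneousComponent G, Finset.mul_sum, map_sum]
  refine Finset.sum_eq_zero fun i _ => ?_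
  have h1 : q * homogeneousComponent i G ∈ homogeneousSubmodule (Fin n) k (e + i) :=
    IsHomogeneous.mul hq (homogeneousComponent_isHomogeneous i G)
  rw [homogeneousComponent_of_mem h1, if_neg (by omega)]

lemma hom_div {e d : ℕ} {q F : MvPolynomial (Fin n) k} (hq : q ∈ Rd k n e)
    (hF : F ∈ Rd k n (e + d)) (h : q ∣ F) : ∃ G ∈ Rd k n d, F = q * G := by
  obtain ⟨G, rfl⟩ := h
  refine ⟨homogeneousComponent d G, homogeneousComponent_isHomogeneous d G, ?_⟩
  rw [← homComp_mul hq, homogeneousComponent_of_mem hF, if_pos rfl]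

lemma hom_div_lt {e d : ℕ} (hd : d < e) {q F : MvPolynomial (Fin n) k} (hq : q ∈ Rd k n e)
    (hF : F ∈ Rd k n d) (h : q ∣ F) : F = 0 := by
  obtain ⟨G, rfl⟩ := h
  have := homComp_mul_lt (G := G) hd hq
  rwa [homogeneousComponent_of_mem hF, if_pos rfl] at this

lemma X_dvd_of_subst (i : Fin n) (F : MvPolynomial (Fin n) k)
    (h : aeval (fun j => if j = i then (0 : MvPolynomial (Fin n) k) else X j) F = 0) : X i ∣ F := by
  have h1 := aeval_sub_mem (Ideal.span {(X i : MvPolynomial (Fin n) k)}) X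
    (fun j => if j = i then (0 : MvPolynomial (Fin n) k) else X j) (fun j => by
      by_cases hj : j = i
      · subst hj; simp
      · simp [hj]) F
  rw [h, sub_zero] at h1
  rw [aeval_X_left_apply] at h1
  exact Ideal.mem_span_singleton.1 h1

end Hom

section Quadric
variable {k : Type} [Field k]

/-- chart of the quadric -/
def sg (x : Fin 2 → k) : Fin 4 → k := ![1, x 1, x 0, x 0 * x 1]

noncomputable def qd (k : Type) [Field k] : MvPolynomial (Fin 4) k := X 0 * X 3 - X 1 * X 2

lemma qd_mem : qd k ∈ Rd k 4 2 :=
  Submodule.sub_mem _ (IsHomogeneous.mul (isHomogeneous_X k 0) (isHomogeneous_X k 3))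
    (IsHomogeneous.mul (isHomogeneous_X k 1) (isHomogeneous_X k 2))

lemma X0_cancel {F G : MvPolynomial (Fin 4) k} (h : X 0 * F = qd k * G) : qd k ∣ F := by
  have h0 := congrArg (aeval (fun j => if j = 0 then (0 : MvPolynomial (Fin 4) k) else X j)) h
  simp [qd, X_ne_zero] at h0
  obtain ⟨G', rfl⟩ := X_dvd_of_subst 0 G h0
  refine ⟨G', ?_⟩
  have : (X 0 : MvPolynomial (Fin 4) k) * F = X 0 * (qd k * G') := by rw [h]; ring
  exact mul_left_cancel₀ (X_ne_zero _) this

lemma X0_pow_cancel (m : ℕ) {F : MvPolynomial (Fin 4) k} (h : qd k ∣ X 0 ^ m * F) : qd k ∣ F := by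
  induction m with
  | zero => simpa using h
  | succ m ih =>
    obtain ⟨G, hG⟩ := h
    exact ih (X0_cancel (G := G) (by rw [← hG]; ring))

lemma qd_dvd [Infinite k] {d : ℕ} {F : MvPolynomial (Fin 4) k} (hF : F ∈ Rd k 4 d)
    (h : ∀ x, eval (sg x) F = 0) : qd k ∣ F := by
  let g : Fin 4 → MvPolynomial (Fin 4) k := ![X 0 * X 0, X 0 * X 1, X 0 * X 2, X 1 * X 2]
  have h1 := aeval_sub_mem (Ideal.span {qd k}) (fun j => X 0 * X j) g (by
    intro i
    fin_cases i
    · simp [g]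
    · simp [g]
    · simp [g]
    · exact Ideal.mem_span_singleton_self (qd k)) F
  rw [aeval_smul_hom hF, aeval_X_left_apply] at h1
  have h2 : aeval g F = 0 := by
    have h3 : X 0 * aeval g F = 0 := by
      apply MvPolynomial.funext
      intro p
      rw [map_mul, eval_X, map_zero]
      by_cases hp : p 0 = 0
      · simp [hp]
      rw [mul_eq_zero]
      right
      have e1 : eval p (aeval g F) = eval (fun i => eval p (g i)) F := by
        have : ((aeval p : MvPolynomial (Fin 4) k →ₐ[k] k).comp (aeval g)) = 
          aeval (fun i => eval p (g i)) := by
          ext i; simp [aeval_eq_eval]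
        have := congrArg (fun φ => φ F) this
        simpa [aeval_eq_eval] using this
      have e2 : (fun i => eval p (g i)) = (p 0 * p 0) • sg ![p 2 / p 0, p 1 / p 0] := by
        ext i
        fin_cases i <;> simp [g, sg] <;> field_simp
      rw [e1, e2, eval_smul_hom hF, h, mul_zero]
    exact (mul_eq_zero.1 h3).resolve_left (X_ne_zero _)
  rw [h2, sub_zero] at h1
  exact X0_pow_cancel d (Ideal.mem_span_singleton.1 h1)

lemma chart_poly {d : ℕ} {F : MvPolynomial (Fin 4) k} (hF : F ∈ Rd k 4 d) :
    ∃ g : Fin (d + 1) → Polynomial k, (∀ j, (g j).natDegree ≤ d) ∧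
      ∀ x, eval (sg x) F = ∑ j, (g j).eval (x 0) * x 1 ^ (j : ℕ) := by
  have hm : ∀ m ∈ F.support, m 0 + m 1 + m 2 + m 3 = d := by
    intro m hm
    have h := hF (mem_support_iff.1 hm)
    rw [← h, Finsupp.weight_apply, Finsupp.sum_fintype _ _ (by simp)]; simp [Fin.sum_univ_four]
  refine ⟨fun j => ∑ m ∈ F.support, if m 1 + m 3 = (j : ℕ) then
    Polynomial.C (coeff m F) * Polynomial.X ^ (m 2 + m 3) else 0, ?_, ?_⟩
  · intro j
    refine Polynomial.natDegree_sum_le_of_forall_le _ _ fun m hmm => ?_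
    split_ifs
    · refine (Polynomial.natDegree_C_mul_X_pow_le _ _).trans ?_
      have := hm m hmm
      omega
    · simp
  · intro x
    rw [eval_eq']
    simp only [Polynomial.eval_finsetSum, Finset.sum_mul]
    rw [Finset.sum_comm]
    refine Finset.sum_congr rfl fun m hmm => ?_
    have := hm m hmm
    rw [Finset.sum_eq_single (⟨m 1 + m 3, by omega⟩ : Fin (d + 1))]
    · simp [sg, Fin.prod_univ_four]; ring
    · intro j _ hj
      rw [if_neg]
      · simp
      · intro h; apply hj; ext; exact h.symm
    · simp
end Quadric


section Step
variable {k : Type} [Field k]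

lemma lineK_of_mul [Infinite k] {n : ℕ} {u v : Fin n → k} {q G : MvPolynomial (Fin n) k}
    (h : q * G ∈ lineK u v) (a₀ b₀ : k) (h0 : eval (a₀ • u + b₀ • v) q ≠ 0) : G ∈ lineK u v := by
  rw [mem_lineK] at h ⊢
  intro a b
  set P := a • u + b • v with hP
  set w := (a₀ - a) • u + (b₀ - b) • v with hw
  have h1 : lineP P w (q * G) = 0 := by
    apply Polynomial.funext
    intro c
    rw [eval_lineP, Polynomial.eval_zero, ← h (a + c * (a₀ - a)) (b + c * (b₀ - b))]
    congr 2
    rw [hP, hw]; module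
  have h2 : lineP P w q ≠ 0 := by
    intro hh
    have := eval_lineP P w q 1
    rw [hh, Polynomial.eval_zero] at this
    apply h0
    rw [this]
    congr 2
    rw [hP, hw]; module
  rw [map_mul] at h1
  have h3 := (mul_eq_zero.1 h1).resolve_left h2
  have := eval_lineP P w G 0
  rw [h3] at this
  simpa using this.symm

/-- residual forms after removing the quadric -/
noncomputable def RdS (k : Type) [Field k] (d : ℕ) : Submodule k (MvPolynomial (Fin 4) k) :=
  if 2 ≤ d then Rd k 4 (d - 2) else ⊥

instance (d : ℕ) : FiniteDimensional k (RdS k d) := by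
  by_cases h : 2 ≤ d
  · have : RdS k d = Rd k 4 (d - 2) := if_pos h
    rw [this]; infer_instance
  · have : RdS k d = ⊥ := if_neg h
    rw [this]; infer_instance

lemma qd_div [Infinite k] {d : ℕ} {F : MvPolynomial (Fin 4) k} (hF : F ∈ Rd k 4 d)
    (h : ∀ x, eval (sg x) F = 0) : ∃ G ∈ RdS k d, F = qd k * G := by
  have h1 := qd_dvd hF h
  unfold RdS
  split_ifs with hd
  · obtain ⟨e, rfl⟩ := Nat.exists_eq_add_of_le hd
    simpa using hom_div qd_mem hF h1
  · exact ⟨0, by simp, by simpa using hom_div_lt (by omega) qd_mem hF h1⟩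

/-- bihomogeneous evaluation -/
noncomputable def evh (d m : ℕ) (x : Fin 2 → k) : (Fin (d + 1) → Fin m → k) →ₗ[k] k where
  toFun h := ∑ j : Fin (d + 1), (∑ i : Fin m, h j i * x 0 ^ (i : ℕ)) * x 1 ^ (j : ℕ)
  map_add' h h' := by
    simp only [Pi.add_apply, add_mul, Finset.sum_add_distrib]
  map_smul' c h := by
    simp only [Pi.smul_apply, smul_eq_mul, Finset.mul_sum, mul_assoc, RingHom.id_apply,
      Finset.sum_mul]

lemma evh_apply (d m : ℕ) (x : Fin 2 → k) (h) : evh d m x h =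
    ∑ j : Fin (d + 1), (∑ i : Fin m, h j i * x 0 ^ (i : ℕ)) * x 1 ^ (j : ℕ) := rfl

lemma polyFn_coord {ι κ μ : Type*} (j : ι) (a : κ) (i : μ) :
    PolyFn (fun z : ι → κ → μ → k => z j a i) := fun x y =>
  ⟨Polynomial.C (x j a i) + Polynomial.C (y j a i) * Polynomial.X, fun c => by simp [mul_comm c]⟩

lemma sum_pow_zero [Infinite k] {m : ℕ} (a : Fin m → k)
    (h : ∀ t : k, ∑ i, a i * t ^ (i : ℕ) = 0) : ∀ i, a i = 0 := by
  have h1 : (∑ i : Fin m, Polynomial.C (a i) * Polynomial.X ^ (i : ℕ)) = 0 := by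
    apply Polynomial.funext
    intro t
    simpa [Polynomial.eval_finsetSum] using h t
  intro i
  have h2 := congrArg (fun p => Polynomial.coeff p i) h1
  simp only [Polynomial.finsetSum_coeff, Polynomial.coeff_C_mul, Polynomial.coeff_X_pow,
    Polynomial.coeff_zero] at h2
  rw [Finset.sum_eq_single i] at h2
  · simpa using h2
  · intro j _ hj
    rw [if_neg]
    · simp
    · intro h; exact hj (Fin.ext h.symm)
  · simp

lemma evh_bot [Infinite k] (d m : ℕ) :
    (⊤ : Submodule k (Fin (d + 1) → Fin m → k)) ⊓ ⨅ x, LinearMap.ker (evh d m x) = ⊥ := by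
  rw [eq_bot_iff]
  intro h hh
  simp only [Submodule.mem_inf, Submodule.mem_iInf, LinearMap.mem_ker, evh_apply] at hh
  rw [Submodule.mem_bot]
  funext j i
  refine sum_pow_zero (h j) (fun t => ?_) i
  exact sum_pow_zero (fun j => ∑ i : Fin m, h j i * t ^ (i : ℕ))
    (fun v => by simpa using hh.2 ![t, v]) j

lemma polyFn_sg {E : Type*} [AddCommGroup E] [Module k E] {x : E → Fin 2 → k}
    (hx : ∀ i, PolyFn (fun e => x e i)) (i : Fin 4) : PolyFn (fun e => sg (x e) i) := by
  fin_cases i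
  · exact PolyFn.const 1
  · exact hx 1
  · exact hx 0
  · exact (hx 0).mul (hx 1)

lemma polyFn_evh {E : Type*} [AddCommGroup E] [Module k E] {x : E → Fin 2 → k}
    (hx : ∀ i, PolyFn (fun e => x e i)) (d m : ℕ) (h) : PolyFn (fun e => evh d m (x e) h) := by
  simp only [evh_apply]
  exact PolyFn.sum _ fun j _ => (PolyFn.sum _ fun i _ => (PolyFn.const _).mul ((hx 0).pow _)).mul
    ((hx 1).pow _)

/-- lines spanned by points of the chart -/
noncomputable def chK {ι : Type} (z : ι → Fin 2 → Fin 2 → k) :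
    Submodule k (MvPolynomial (Fin 4) k) := ⨅ j, lineK (sg (z j 0)) (sg (z j 1))

lemma quad_generic [Infinite k] {ι : Type} [Fintype ι] [DecidableEq ι] (d m m' : ℕ)
    (hres : ∃ z : ι → Fin 2 → Fin 2 → k,
      Module.finrank k (RdS k d ⊓ chK z : Submodule k (MvPolynomial (Fin 4) k)) ≤ m') :
    ∃ z : ι → Fin 2 → Fin 2 → k,
      Module.finrank k (RdS k d ⊓ chK z : Submodule k (MvPolynomial (Fin 4) k)) ≤ m' ∧
      Module.finrank k ((⊤ : Submodule k (Fin (d + 1) → Fin m → k)) ⊓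
        ⨅ p : ι × Fin 2, LinearMap.ker (evh d m (z p.1 p.2)) : Submodule k _)
        ≤ (d + 1) * m - 2 * Fintype.card ι ∧
      ∀ p p' : ι × Fin 2, p ≠ p' →
        (z p.1 p.2 0 - z p'.1 p'.2 0) * (z p.1 p.2 1 - z p'.1 p'.2 1) ≠ 0 := by
  have hco : ∀ j a i, PolyFn (fun z : ι → Fin 2 → Fin 2 → k => z j a i) := polyFn_coord
  refine Op.exists_and (k := k) ?_ (Op.and ?_ ?_) hres (Op.exists_and (k := k) ?_ ?_ ?_ ?_)
  · exact op_ker _ (AlgFam.iInf fun j => algFam_line (polyFn_sg (hco j 0)) (polyFn_sg (hco j 1))) _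
  · exact op_ker _ (AlgFam.iInf fun j => AlgFam.single _ (polyFn_evh (hco _ _) _ _)) _
  · refine Op.all fun p => Op.all fun p' => ?_
    by_cases h : p = p'
    · intro x y _; simp [h]
    · simp only [ne_eq, h, not_false_eq_true, forall_const]
      exact Op.ne_zero (((hco _ _ _).sub (hco _ _ _)).mul ((hco _ _ _).sub (hco _ _ _)))
  · exact op_ker _ (AlgFam.iInf fun j => AlgFam.single _ (polyFn_evh (hco _ _) _ _)) _
  · refine Op.all fun p => Op.all fun p' => ?_
    by_cases h : p = p'
    · intro x y _; simp [h]
    · simp only [ne_eq, h, not_false_eq_true, forall_const]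
      exact Op.ne_zero (((hco _ _ _).sub (hco _ _ _)).mul ((hco _ _ _).sub (hco _ _ _)))
  · obtain ⟨c, hc⟩ := exists_points _ _ (evh_bot (k := k) d m) (ι × Fin 2)
    refine ⟨fun j a => c (j, a), hc.trans ?_⟩
    simp [Module.finrank_pi_fintype]
    omega
  · obtain ⟨φ⟩ : Nonempty (ι × Fin 2 ↪ k) :=
      ⟨(Fintype.equivFin _).toEmbedding.trans (Fin.valEmbedding.trans (Infinite.natEmbedding k))⟩
    refine ⟨fun j a _ => φ (j, a), fun p p' h => ?_⟩
    have : φ p - φ p' ≠ 0 := sub_ne_zero.2 (φ.injective.ne h)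
    exact mul_ne_zero this this

end Step


section QStep
variable {k : Type} [Field k]

lemma eta2 {k : Type} (x : Fin 2 → k) : x = ![x 0, x 1] := by
  ext i; fin_cases i <;> rfl

lemma sg_affine (c v₀ v₁ v : k) (h : v₁ - v₀ = 1) :
    sg ![c, v] = (1 - (v - v₀)) • sg ![c, v₀] + (v - v₀) • sg ![c, v₁] := by
  obtain rfl : v₁ = v₀ + 1 := by linear_combination h
  ext i
  fin_cases i <;> simp [sg] <;> ring

lemma qd_line (a b : k) (x y : Fin 2 → k) :
    eval (a • sg x + b • sg y) (qd k) = a * b * ((x 0 - y 0) * (x 1 - y 1)) := by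
  simp [qd, sg]; ring

lemma prod_dvd {m : ℕ} {c : Fin m → k} (hc : Function.Injective c) {p : Polynomial k}
    (h : ∀ i, p.eval (c i) = 0) : (∏ i, (Polynomial.X - Polynomial.C (c i))) ∣ p := by
  refine Finset.prod_dvd_of_coprime ?_ fun i _ => Polynomial.dvd_iff_isRoot.2 (h i)
  intro i _ j _ hij
  exact Polynomial.pairwise_coprime_X_sub_C hc hij

lemma quot_sum {K d : ℕ} {c : Fin K → k} {p r : Polynomial k} (hp : p.natDegree ≤ d)
    (h : p = (∏ i, (Polynomial.X - Polynomial.C (c i))) * r) (t : k) :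
    r.eval t = ∑ i : Fin (d + 1 - K), r.coeff i * t ^ (i : ℕ) := by
  by_cases hr : r = 0
  · simp [hr]
  have hm : (∏ i, (Polynomial.X - Polynomial.C (c i))).Monic :=
    Polynomial.monic_prod_of_monic _ _ fun i _ => Polynomial.monic_X_sub_C _
  have h1 : p.natDegree = K + r.natDegree := by
    rw [h, hm.natDegree_mul' hr, Polynomial.natDegree_prod_of_monic]
    · simp
    · exact fun i _ => Polynomial.monic_X_sub_C _
  rw [Polynomial.eval_eq_sum_range' (n := d + 1 - K) (by omega), Finset.sum_range]

variable [Infinite k]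

lemma ruling_zero {d : ℕ} {F : MvPolynomial (Fin 4) k} {g : Fin (d + 1) → Polynomial k}
    (hg : ∀ x, eval (sg x) F = ∑ j, (g j).eval (x 0) * x 1 ^ (j : ℕ)) {c v₀ v₁ : k}
    (h : v₁ - v₀ = 1) (hF : F ∈ lineK (sg ![c, v₀]) (sg ![c, v₁])) : ∀ j, (g j).eval c = 0 := by
  refine sum_pow_zero (fun j => (g j).eval c) fun v => ?_
  have := hg ![c, v]
  rw [sg_affine c v₀ v₁ v h, mem_lineK.1 hF] at this
  simpa using this.symm

/-- sundial adapted to the quadric -/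
def qsun (z : Fin 2 → Fin 2 → k) : Fin 4 → Fin 4 → k :=
  ![sg (z 0), sg ![z 0 0, z 0 1 + 1], sg (z 1), ![0, 0, 1, z 0 1]]

lemma quad_step (d s n' K' : ℕ)
    (hres : ∃ z : (Fin s ⊕ Fin n') → Fin 2 → Fin 2 → k,
      Module.finrank k (RdS k d ⊓ chK z : Submodule k (MvPolynomial (Fin 4) k)) 
        ≤ (d + 1).choose 3 - (s + n') * (d - 1)) :
    ∃ (σ : Fin s → Fin 4 → Fin 4 → k) (L : Fin n' ⊕ Fin K' → Fin 2 → Fin 2 → k),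
      Module.finrank k (Rd k 4 d ⊓ cfgK σ (fun j a => sg (L j a)) : Submodule k _)
        ≤ (d + 1).choose 3 - (s + n') * (d - 1) +
          ((d + 1) * (d + 1 - (s + K')) - 2 * (s + n')) := by
  classical
  obtain ⟨z, hz1, hz2, hz3⟩ := quad_generic d (d + 1 - (s + K')) _ hres
  -- choose extra ruling parameters
  have hfin : (Set.range (fun p : (Fin s ⊕ Fin n') × Fin 2 => z p.1 p.2 0)).Finite :=
    Set.finite_range _
  have hinf := hfin.infinite_compl
  let c' : Fin K' → k := fun i => hinf.natEmbedding _ i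
  have hc'inj : Function.Injective c' := fun i j h =>
    Fin.ext ((hinf.natEmbedding _).injective (Subtype.ext h))
  have hc' : ∀ i (p : (Fin s ⊕ Fin n') × Fin 2), c' i ≠ z p.1 p.2 0 := fun i p h =>
    (hinf.natEmbedding _ i).2 ⟨p, h.symm⟩
  have hz30 : ∀ p p' : (Fin s ⊕ Fin n') × Fin 2, p ≠ p' → z p.1 p.2 0 ≠ z p'.1 p'.2 0 :=
    fun p p' h => sub_ne_zero.1 (left_ne_zero_of_mul (hz3 p p' h))
  let c : Fin (s + K') → k := Fin.append (fun i => z (Sum.inl i) 0 0) c'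
  have hcs : ∀ i, c (Fin.castAdd K' i) = z (Sum.inl i) 0 0 := fun i => by simp [c]
  have hck : ∀ i, c (Fin.natAdd s i) = c' i := fun i => by simp [c]
  have hcinj : Function.Injective c := by
    intro i
    refine Fin.addCases (fun i j => ?_) (fun i j => ?_) i
    · refine Fin.addCases (fun j h => ?_) (fun j h => ?_) j
      · rw [hcs, hcs] at h
        by_contra hne
        exact hz30 (Sum.inl i, 0) (Sum.inl j, 0) (by
          intro h'; apply hne; simp at h'; rw [h']) h
      · rw [hcs, hck] at h
        exact absurd h.symm (hc' j (Sum.inl i, 0))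
    · refine Fin.addCases (fun j h => ?_) (fun j h => ?_) j
      · rw [hcs, hck] at h
        exact absurd h (hc' i (Sum.inl j, 0))
      · rw [hck, hck] at h
        rw [hc'inj h]
  -- points whose t-coordinate is not a ruling parameter
  have hcne : ∀ p : (Fin s ⊕ Fin n') × Fin 2, (∀ i, p ≠ (Sum.inl i, 0)) →
      ∀ i, z p.1 p.2 0 - c i ≠ 0 := by
    intro p hp i
    rw [sub_ne_zero]
    refine Fin.addCases (fun i => ?_) (fun i => ?_) i
    · rw [hcs]; exact hz30 p (Sum.inl i, 0) (hp i)
    · rw [hck]; exact (hc' i p).symm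
  refine ⟨fun i => qsun (z (Sum.inl i)),
    Sum.elim (fun j => z (Sum.inr j)) (fun i => ![![c' i, 0], ![c' i, 1]]), ?_⟩
  set W : Submodule k (MvPolynomial (Fin 4) k) := Rd k 4 d ⊓ cfgK _ _ with hW
  have : FiniteDimensional k W := Submodule.finiteDimensional_of_le inf_le_left
  have : FiniteDimensional k (RdS k d ⊓ chK z : Submodule k _) :=
    Submodule.finiteDimensional_of_le inf_le_left
  have hWd : ∀ F ∈ W, F ∈ Rd k 4 d := fun F hF => hF.1
  have hWs : ∀ F ∈ W, ∀ i, F ∈ sunK (qsun (z (Sum.inl i))) := fun F hF i =>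
    (Submodule.mem_iInf _).1 hF.2.1 i
  have hWl : ∀ F ∈ W, ∀ j, F ∈ lineK (sg (z (Sum.inr j) 0)) (sg (z (Sum.inr j) 1)) :=
    fun F hF j => (Submodule.mem_iInf _).1 hF.2.2 (Sum.inl j)
  have hWr : ∀ F ∈ W, ∀ i, F ∈ lineK (sg ![c' i, 0]) (sg ![c' i, 1]) :=
    fun F hF i => (Submodule.mem_iInf _).1 hF.2.2 (Sum.inr i)
  have hWz : ∀ F ∈ W, ∀ j, F ∈ lineK (sg (z j 0)) (sg (z j 1)) := by
    intro F hF j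
    rcases j with j | j
    · exact (hWs F hF j).1.2
    · exact hWl F hF j
  let tr : MvPolynomial (Fin 4) k →ₗ[k] ((Fin 2 → k) → k) := LinearMap.pi fun x => evL (sg x)
  refine (finrank_split W (RdS k d ⊓ chK z) tr (LinearMap.mulLeft k (qd k)) ?_).trans ?_
  · rintro F ⟨hF, hF0⟩
    obtain ⟨G, hG, hFG⟩ := qd_div (hWd F hF) (fun x => by
      have := congrFun (LinearMap.mem_ker.1 hF0) x
      simpa [tr, evL_apply] using this)
    refine ⟨G, ⟨hG, ?_⟩, by simp [hFG]⟩
    refine (Submodule.mem_iInf _).2 fun j => ?_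
    have := hWz F hF j
    rw [hFG] at this
    refine lineK_of_mul this 1 1 ?_
    rw [qd_line]
    simpa using hz3 (j, 0) (j, 1) (by simp)
  refine add_le_add hz1 ?_
  let Φ : (Fin (d + 1) → Fin (d + 1 - (s + K')) → k) →ₗ[k] ((Fin 2 → k) → k) :=
    LinearMap.pi fun x => (∏ i, (x 0 - c i)) • evh d _ x
  have hmap : W.map tr ≤ ((⊤ : Submodule k (Fin (d + 1) → Fin (d + 1 - (s + K')) → k)) ⊓
      ⨅ p : (Fin s ⊕ Fin n') × Fin 2, LinearMap.ker (evh d _ (z p.1 p.2))).map Φ := by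
    rintro _ ⟨F, hF, rfl⟩
    obtain ⟨g, hgd, hg⟩ := chart_poly (hWd F hF)
    have hroot : ∀ j i, (g j).eval (c i) = 0 := by
      intro j i
      refine Fin.addCases (fun i => ?_) (fun i => ?_) i
      · rw [hcs]
        refine ruling_zero hg (v₀ := z (Sum.inl i) 0 1) (v₁ := z (Sum.inl i) 0 1 + 1) (by ring) ?_ j
        have := (hWs F hF i).1.1
        rw [← eta2]
        exact this
      · rw [hck]
        exact ruling_zero hg (by ring) (hWr F hF i) j
    choose r hr using fun j => prod_dvd hcinj (hroot j)
    let h : Fin (d + 1) → Fin (d + 1 - (s + K')) → k := fun j i => (r j).coeff i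
    have hev : ∀ x, evh d _ x h = ∑ j, (r j).eval (x 0) * x 1 ^ (j : ℕ) := by
      intro x
      rw [evh_apply]
      refine Finset.sum_congr rfl fun j _ => ?_
      rw [quot_sum (hgd j) (hr j)]
    have hFe : ∀ x, eval (sg x) F = (∏ i, (x 0 - c i)) * evh d _ x h := by
      intro x
      rw [hg, hev, Finset.mul_sum]
      refine Finset.sum_congr rfl fun j _ => ?_
      rw [hr j, Polynomial.eval_mul, Polynomial.eval_prod]
      simp [mul_assoc]
    refine ⟨h, ⟨trivial, (Submodule.mem_iInf _).2 fun p => ?_⟩, ?_⟩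
    · rw [LinearMap.mem_ker]
      by_cases hp : ∀ i, p ≠ (Sum.inl i, 0)
      · have h0 : eval (sg (z p.1 p.2)) F = 0 := by
          have := mem_lineK.1 (hWz F hF p.1)
          obtain ⟨p1, p2⟩ := p
          fin_cases p2
          · simpa using this 1 0
          · simpa using this 0 1
        rw [hFe] at h0
        exact (mul_eq_zero.1 h0).resolve_left (Finset.prod_ne_zero_iff.2 fun i _ => hcne p hp i)
      · push Not at hp
        obtain ⟨i, rfl⟩ := hp
        -- derivative
        set x := z (Sum.inl i) 0 with hx
        have hd0 : dvL (sg x) ![0, 0, 1, x 1] F = 0 := (hWs F hF i).2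
        have hpol : lineP (sg x) ![0, 0, 1, x 1] F =
            Polynomial.X * ((∏ i' ∈ Finset.univ.erase (Fin.castAdd K' i),
              (Polynomial.X + Polynomial.C (x 0 - c i'))) *
              ∑ j, ((r j).comp (Polynomial.X + Polynomial.C (x 0))) *
                Polynomial.C (x 1 ^ (j : ℕ))) := by
          apply Polynomial.funext
          intro e
          rw [eval_lineP]
          have e1 : sg x + e • ![0, 0, 1, x 1] = sg ![x 0 + e, x 1] := by
            ext l
            fin_cases l <;> simp [sg]; ring
          rw [e1, hFe, hev, ← Finset.mul_prod_erase Finset.univ _ (Finset.mem_univ (Fin.castAdd K' i)),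
            hcs]
          simp only [Polynomial.eval_mul, Polynomial.eval_X, Polynomial.eval_prod,
            Polynomial.eval_add, Polynomial.eval_C, Polynomial.eval_finsetSum,
            Polynomial.eval_comp, Matrix.cons_val_zero, Matrix.cons_val_one, ← hx]
          have e2 : ∀ i', x 0 + e - c i' = e + (x 0 - c i') := fun i' => by ring
          simp only [e2, add_comm e (x 0), mul_assoc]
          rw [add_sub_cancel_left]
        rw [dvL_apply, hpol, Polynomial.coeff_X_mul, Polynomial.coeff_zero_eq_eval_zero,
          Polynomial.eval_mul, Polynomial.eval_prod, mul_eq_zero] at hd0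
        have h3 := hd0.resolve_left (by
          refine Finset.prod_ne_zero_iff.2 fun i' hi' => ?_
          simp only [Polynomial.eval_add, Polynomial.eval_X, Polynomial.eval_C, zero_add]
          rw [sub_ne_zero, hx, ← hcs i]
          exact hcinj.ne (Finset.ne_of_mem_erase hi').symm)
        simp only [Polynomial.eval_mul, Polynomial.eval_X, 
            Polynomial.eval_add, Polynomial.eval_C, Polynomial.eval_finsetSum,
            Polynomial.eval_comp, zero_add] at h3
        rw [hev]
        exact h3
    · funext x
      simp [tr, Φ, evL_apply, hFe]
  have := Submodule.finrank_mono hmap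
  have h4 := Submodule.finrank_map_le Φ ((⊤ : Submodule k (Fin (d + 1) → Fin (d + 1 - (s + K')) → k)) ⊓
      ⨅ p : (Fin s ⊕ Fin n') × Fin 2, LinearMap.ker (evh d _ (z p.1 p.2)))
  refine this.trans (h4.trans (hz2.trans ?_))
  simp
end QStep


lemma choose_succ_sq (d : ℕ) : (d + 3).choose 3 = (d + 1).choose 3 + (d + 1) * (d + 1) := by
  have h1 : (d + 3).choose 3 = (d + 2).choose 2 + (d + 2).choose 3 := Nat.choose_succ_succ' _ _
  have h2 : (d + 2).choose 3 = (d + 1).choose 2 + (d + 1).choose 3 := Nat.choose_succ_succ' _ _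
  have h3 : (d + 2).choose 2 = (d + 1).choose 1 + (d + 1).choose 2 := Nat.choose_succ_succ' _ _
  have h4 : (d + 1).choose 2 * 2 = (d + 1) * d := by
    have := Nat.add_one_mul_choose_eq d 1
    simp at this
    linarith
  simp at h3
  nlinarith

lemma six_choose (d : ℕ) : 6 * (d + 2).choose 3 = (d + 2) * (d + 1) * d := by
  induction d with
  | zero => simp [Nat.choose]
  | succ d ih =>
    have h2 : (d + 1 + 2).choose 3 = (d + 2).choose 2 + (d + 2).choose 3 := Nat.choose_succ_succ' _ _
    have h4 : (d + 2).choose 2 * 2 = (d + 2) * (d + 1) := by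
      have := Nat.add_one_mul_choose_eq (d + 1) 1
      simp at this
      linarith
    nlinarith

/-- number of lines of P^3 that we handle -/
def fq (d : ℕ) : ℕ := (d + 2) * (d + 3) / 8 + 1

lemma fq_le (d : ℕ) : fq d * (d + 1) ≤ (d + 3).choose 3 := by
  have h := six_choose (d + 1)
  have h8 : 8 * ((d + 2) * (d + 3) / 8) ≤ (d + 2) * (d + 3) := Nat.mul_div_le _ _
  by_cases hd : d ≤ 2
  · interval_cases d <;> simp [fq, Nat.choose]
  · push Not at hd
    unfold fq
    set a := (d + 2) * (d + 3) / 8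
    obtain ⟨e, rfl⟩ := Nat.exists_eq_add_of_le hd
    simp only [show 2 + 1 + e + 1 + 2 = 2 + 1 + e + 3 by ring] at h
    nlinarith [mul_le_mul_of_nonneg_right h8 (Nat.zero_le (2 + 1 + e + 1))]

lemma combine_bound {d n K : ℕ} (hK : K ≤ d + 1) (h1 : n * (d - 1) ≤ (d + 1).choose 3)
    (h2 : 2 * n ≤ (d + 1) * (d + 1 - K)) :
    (d + 1).choose 3 - n * (d - 1) + ((d + 1) * (d + 1 - K) - 2 * n)
      ≤ (d + 3).choose 3 - (n + K) * (d + 1) := by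
  rw [choose_succ_sq]
  obtain ⟨e, he⟩ : ∃ e, e = d + 1 - K := ⟨_, rfl⟩
  rw [← he] at h2 ⊢
  rcases Nat.eq_zero_or_pos d with rfl | hd
  · have h0 : n = 0 := by omega
    subst h0
    have : e + K = 1 := by omega
    simp; omega
  · obtain ⟨f, rfl⟩ : ∃ f, d = f + 1 := ⟨d - 1, by omega⟩
    simp only [Nat.add_sub_cancel] at *
    have he' : f + 1 + 1 = K + e := by omega
    have e1 : (f + 1 + 1) * (f + 1 + 1) = (f + 1 + 1) * K + (f + 1 + 1) * e := by
      rw [← mul_add, he']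
    have e2 : (n + K) * (f + 1 + 1) = n * f + 2 * n + (f + 1 + 1) * K := by ring
    rw [e1, e2]
    omega

section
variable (k : Type) [Field k]

def Bq (d N : ℕ) : Prop := ∃ z : Fin N → Fin 2 → Fin 2 → k,
  Module.finrank k (Rd k 4 d ⊓ chK z : Submodule k (MvPolynomial (Fin 4) k))
    ≤ (d + 3).choose 3 - N * (d + 1)

variable {k}

lemma chK_equiv {ι ι' : Type} (z : ι → Fin 2 → Fin 2 → k) (e : ι' ≃ ι) : chK (z ∘ e) = chK z := by
  simp only [chK, Function.comp]
  rw [e.iInf_comp (g := fun i => lineK (sg (z i 0)) (sg (z i 1)))]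

variable [Infinite k]

lemma hres_of {d n s n' : ℕ} (hn : s + n' = n) (h : 2 ≤ d → Bq k (d - 2) n) :
    ∃ z : (Fin s ⊕ Fin n') → Fin 2 → Fin 2 → k,
      Module.finrank k (RdS k d ⊓ chK z : Submodule k (MvPolynomial (Fin 4) k)) 
        ≤ (d + 1).choose 3 - (s + n') * (d - 1) := by
  by_cases hd : 2 ≤ d
  · obtain ⟨z, hz⟩ := h hd
    obtain ⟨e, rfl⟩ := Nat.exists_eq_add_of_le hd
    refine ⟨z ∘ (finSumFinEquiv.trans (finCongr hn)), ?_⟩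
    rw [chK_equiv, hn]
    have : RdS k (2 + e) = Rd k 4 e := by simp [RdS]
    rw [this]
    rw [show 2 + e - 2 = e by omega] at hz
    rw [show 2 + e + 1 = e + 3 by ring, show 2 + e - 1 = e + 1 by omega]
    exact hz
  · refine ⟨fun _ _ _ => 0, ?_⟩
    have : RdS k d = ⊥ := by simp [RdS, hd]
    rw [this, bot_inf_eq, finrank_bot]; exact Nat.zero_le _

lemma p3_aux {d s n' K' : ℕ} (hK : s + K' ≤ d + 1) (h : 2 ≤ d → Bq k (d - 2) (s + n'))
    (h1 : (s + n') * (d - 1) ≤ (d + 1).choose 3)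
    (h2 : 2 * (s + n') ≤ (d + 1) * (d + 1 - (s + K'))) :
    ∃ (σ : Fin s → Fin 4 → Fin 4 → k) (L : Fin n' ⊕ Fin K' → Fin 2 → Fin 2 → k),
      Module.finrank k (Rd k 4 d ⊓ cfgK σ (fun j a => sg (L j a)) : Submodule k _)
        ≤ (d + 3).choose 3 - ((s + n') + (s + K')) * (d + 1) := by
  obtain ⟨σ, L, hL⟩ := quad_step d s n' K' (hres_of rfl h)
  exact ⟨σ, L, hL.trans (combine_bound hK h1 h2)⟩

lemma fq_sub (d n : ℕ) (hd : 2 ≤ d) (hn : n ≤ fq (d - 2)) : n * (d - 1) ≤ (d + 1).choose 3 := by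
  obtain ⟨e, rfl⟩ := Nat.exists_eq_add_of_le hd
  have := fq_le e
  simp only [Nat.add_sub_cancel_left] at hn
  rw [show 2 + e + 1 = e + 3 by ring, show 2 + e - 1 = e + 1 by omega]
  exact (Nat.mul_le_mul_right _ hn).trans this

lemma bq (d : ℕ) : ∀ N ≤ fq d, Bq k d N := by
  induction d using Nat.strong_induction_on with
  | _ d ih =>
  intro N hN
  have key : ∃ n K, n + K = N ∧ (2 ≤ d → n ≤ fq (d - 2)) ∧ (d < 2 → n = 0) ∧ K ≤ d + 1 ∧
      2 * n ≤ (d + 1) * (d + 1 - K) := by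
    by_cases hd : 2 ≤ d
    · refine ⟨min N (fq (d - 2)), N - min N (fq (d - 2)), by omega, fun _ => by omega,
        by omega, ?_⟩
      obtain ⟨e, rfl⟩ := Nat.exists_eq_add_of_le hd
      simp only [Nat.add_sub_cancel_left]
      have hA1 : 8 * ((e + 2) * (e + 3) / 8) ≤ (e + 2) * (e + 3) := Nat.mul_div_le _ _
      have hA2 : (e + 2) * (e + 3) < 8 * ((e + 2) * (e + 3) / 8) + 8 := by omega
      have hB1 : 8 * ((2 + e + 2) * (2 + e + 3) / 8) ≤ (2 + e + 2) * (2 + e + 3) :=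
        Nat.mul_div_le _ _
      by_cases he : e ≤ 2
      · interval_cases e
        · simp [fq] at hN ⊢; interval_cases N <;> simp
        · simp [fq] at hN ⊢; interval_cases N <;> simp
        · simp [fq] at hN ⊢; interval_cases N <;> simp
      unfold fq at *
      set A := (e + 2) * (e + 3) / 8
      set B := (2 + e + 2) * (2 + e + 3) / 8
      obtain ⟨K, hK⟩ : ∃ K, K = N - min N (A + 1) := ⟨_, rfl⟩
      have hK8 : 8 * K ≤ 4 * e + 21 := by
        have : (2 + e + 2) * (2 + e + 3) = (e + 2) * (e + 3) + 4 * e + 14 := by ring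
        omega
      obtain ⟨E, hE⟩ : ∃ E, E = 2 + e + 1 - K := ⟨_, rfl⟩
      have hE8 : 4 * e + 3 ≤ 8 * E := by omega
      rw [← hK, ← hE]
      refine ⟨by omega, ?_⟩
      have h3 : min N (A + 1) ≤ A + 1 := min_le_right _ _
      push Not at he
      obtain ⟨f, rfl⟩ := Nat.exists_eq_add_of_le he
      nlinarith [Nat.mul_le_mul_left (2 + (2 + 1 + f) + 1) hE8]
    · refine ⟨0, N, by omega, by omega, fun _ => rfl, ?_, by omega⟩
      have : d = 0 ∨ d = 1 := by omega
      rcases this with rfl | rfl <;> simp [fq] at hN <;> omega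
  obtain ⟨n, K, rfl, hn, hn0, hK, h2⟩ := key
  obtain ⟨σ, L, hL⟩ := p3_aux (k := k) (d := d) (s := 0) (n' := n) (K' := K) (by omega)
    (fun hd => by rw [zero_add]; exact ih (d - 2) (by omega) n (hn hd))
    (by
      rw [zero_add]
      by_cases hd : 2 ≤ d
      · exact fq_sub d n hd (hn hd)
      · rw [hn0 (by omega)]; simp) (by simpa using h2)
  refine ⟨L ∘ finSumFinEquiv.symm, ?_⟩
  rw [chK_equiv]
  have e1 : cfgK σ (fun j a => sg (L j a)) = chK L := by
    simp [cfgK, chK]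
  rw [e1] at hL
  simpa using hL

lemma p3 {d s n K : ℕ} (hsn : s ≤ n) (hsK : s ≤ K) (hK : K ≤ d + 1) (hn : 2 ≤ d → n ≤ fq (d - 2))
    (hn0 : d < 2 → n = 0)
    (h2 : 2 * n ≤ (d + 1) * (d + 1 - K)) :
    Cfg k 4 s (n + K - 2 * s) d ((d + 3).choose 3 - (n + K) * (d + 1)) := by
  obtain ⟨n', rfl⟩ := Nat.exists_eq_add_of_le hsn
  obtain ⟨K', rfl⟩ := Nat.exists_eq_add_of_le hsK
  obtain ⟨σ, L, hL⟩ := p3_aux (k := k) (d := d) (s := s) (n' := n') (K' := K') hK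
    (fun hd => bq (d - 2) _ (hn hd))
    (by
      by_cases hd : 2 ≤ d
      · exact fq_sub d _ hd (hn hd)
      · rw [hn0 (by omega)]; simp) h2
  exact Cfg.of_types (by simp) (by simp; omega) σ _ hL
end


section P4
variable {k : Type} [Field k]

/-- embedding of the hyperplane -/
def emb (p : Fin 4 → k) : Fin 5 → k := Fin.cons 0 p

def e0 (k : Type) [Field k] : Fin 5 → k := Fin.cons 1 0

/-- restriction to the hyperplane -/
noncomputable def rho (k : Type) [Field k] : MvPolynomial (Fin 5) k →ₐ[k] MvPolynomial (Fin 4) k :=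
  aeval (Fin.cons 0 X : Fin 5 → MvPolynomial (Fin 4) k)

/-- intersection of a line with the hyperplane -/
def pt (u v : Fin 5 → k) : Fin 4 → k := fun i => u 0 * v i.succ - v 0 * u i.succ

lemma emb_pt (u v : Fin 5 → k) : emb (pt u v) = (-v 0) • u + (u 0) • v := by
  ext i
  refine Fin.cases ?_ (fun i => ?_) i
  · simp [emb]; ring
  · simp [emb, pt]; ring

lemma pt_e0 (p : Fin 4 → k) : pt (e0 k) (emb p) = p := by
  ext i; simp [pt, e0, emb]

lemma lineP_rho (P w : Fin 4 → k) (F) : lineP P w (rho k F) = lineP (emb P) (emb w) F := by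
  have : (lineP P w).comp (rho k) = lineP (emb P) (emb w) := by
    ext i
    refine Fin.cases ?_ (fun i => ?_) i
    · simp [rho, lineP, emb]
    · simp [rho, lineP, emb]
  exact congrArg (fun f => f F) this

lemma eval_rho (p : Fin 4 → k) (F) : eval p (rho k F) = eval (emb p) F := by
  rw [← coeff_zero_lineP p 0, lineP_rho, coeff_zero_lineP]

lemma dvL_rho (P w : Fin 4 → k) (F) : dvL P w (rho k F) = dvL (emb P) (emb w) F := by
  rw [dvL_apply, lineP_rho, dvL_apply]

lemma rho_mem {d : ℕ} {F} (hF : F ∈ Rd k 5 d) : rho k F ∈ Rd k 4 d := by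
  have := IsHomogeneous.aeval hF (Fin.cons 0 X : Fin 5 → MvPolynomial (Fin 4) k) (n := 1) (by
    intro i
    refine Fin.cases ?_ (fun i => ?_) i
    · simpa using isHomogeneous_zero _ _ _
    · simpa using isHomogeneous_X _ _)
  rwa [one_mul] at this

lemma X0_dvd {F} (h : rho k F = 0) : X 0 ∣ F := by
  apply X_dvd_of_subst
  have : (aeval (fun j => if j = 0 then (0 : MvPolynomial (Fin 5) k) else X j)) =
      (rename Fin.succ : MvPolynomial (Fin 4) k →ₐ[k] _).comp (rho k) := by
    ext1 i
    refine Fin.cases ?_ (fun i => ?_) i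
    · simp [rho]
    · simp [rho, Fin.succ_ne_zero]
  rw [this, AlgHom.comp_apply, h, map_zero]

lemma X0_div {d : ℕ} {F} (hF : F ∈ Rd k 5 (1 + d)) (h : rho k F = 0) :
    ∃ G ∈ Rd k 5 d, F = X 0 * G := hom_div (isHomogeneous_X k 0) hF (X0_dvd h)

lemma lineK_emb {F} {u v : Fin 4 → k} (h : F ∈ lineK (emb u) (emb v)) : rho k F ∈ lineK u v := by
  rw [mem_lineK] at h ⊢
  intro a b
  rw [eval_rho, ← h a b]
  congr 2
  ext i
  refine Fin.cases ?_ (fun i => ?_) i <;> simp [emb]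

variable [Infinite k]

lemma rho_zero {F} (h : ∀ p, eval (emb p) F = 0) : rho k F = 0 := by
  apply MvPolynomial.funext
  intro p
  rw [eval_rho, h, map_zero]

lemma cfgK_resid {ι κ : Type} {σ : ι → Fin 4 → Fin 5 → k} {L : κ → Fin 2 → Fin 5 → k}
    (h1 : ∀ i, σ i 0 0 ≠ 0) (h2 : ∀ j, L j 0 0 ≠ 0) {G} (h : X 0 * G ∈ cfgK σ L) :
    G ∈ cfgK σ L := by
  refine ⟨(Submodule.mem_iInf _).2 fun i => ?_, (Submodule.mem_iInf _).2 fun j => ?_⟩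
  · have hi := (Submodule.mem_iInf _).1 h.1 i
    have g1 : G ∈ lineK (σ i 0) (σ i 1) := lineK_of_mul hi.1.1 1 0 (by simpa using h1 i)
    have g2 : G ∈ lineK (σ i 0) (σ i 2) := lineK_of_mul hi.1.2 1 0 (by simpa using h1 i)
    refine ⟨⟨g1, g2⟩, ?_⟩
    have hd : dvL (σ i 0) (σ i 3) (X 0 * G) = 0 := hi.2
    rw [dvL_mul] at hd
    have h0 : eval (σ i 0) G = 0 := by simpa using mem_lineK.1 g1 1 0
    rw [h0, mul_zero, add_zero, eval_X] at hd
    exact (mul_eq_zero.1 hd).resolve_left (h1 i)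
  · exact lineK_of_mul ((Submodule.mem_iInf _).1 h.2 j) 1 0 (by simpa using h2 j)

/-- existence part for the residual scheme -/
lemma step_resid {d s l a : ℕ} (h1 : Cfg k 5 s l d a) (h2 : a = 0 ∨ (1 ≤ d ∧ Cfg k 5 s l (d - 1) 0)) :
    ∃ (σ : Fin s → Fin 4 → Fin 5 → k) (L : Fin l → Fin 2 → Fin 5 → k) (c : Fin a → Fin 4 → k),
      Module.finrank k (Rd k 5 d ⊓ (cfgK σ L ⊓ ⨅ i, LinearMap.ker (evL (emb (c i)))) :
        Submodule k (MvPolynomial (Fin 5) k)) ≤ 0 := by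
  rcases h2 with rfl | ⟨hd, h2⟩
  · obtain ⟨σ, L, h⟩ := h1
    refine ⟨σ, L, fun _ => 0, le_trans (Submodule.finrank_mono ?_) h⟩
    exact inf_le_inf_left _ inf_le_left
  · let E := (Fin s → Fin 4 → Fin 5 → k) × (Fin l → Fin 2 → Fin 5 → k)
    have hco1 : ∀ j a i, PolyFn (fun x : E => x.1 j a i) := fun j a i =>
      fun x y => polyFn_coord j a i x.1 y.1
    have hco2 : ∀ j a i, PolyFn (fun x : E => x.2 j a i) := fun j a i =>
      fun x y => polyFn_coord j a i x.2 y.2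
    have hK : AlgFam (fun x : E => cfgK x.1 x.2) := algFam_cfg hco1 hco2
    obtain ⟨σ₁, L₁, h1⟩ := h1
    obtain ⟨σ₂, L₂, h2⟩ := h2
    have o3 : Op k (fun x : E => (∀ i, x.1 i 0 0 ≠ 0) ∧ (∀ j, x.2 j 0 0 ≠ 0)) :=
      (Op.all fun i => Op.ne_zero (hco1 i 0 0)).and (Op.all fun i => Op.ne_zero (hco2 i 0 0))
    have o2 := op_ker (Rd k 5 (d - 1)) hK 0
    have o1 := op_ker (Rd k 5 d) hK a
    obtain ⟨⟨σ, L⟩, hx1, hx2, hx3, hx4⟩ := Op.exists_and o1 (o2.and o3) ⟨(σ₁, L₁), h1⟩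
      (Op.exists_and o2 o3 ⟨(σ₂, L₂), h2⟩ ⟨(fun _ _ _ => 1, fun _ _ _ => 1), by simp⟩)
    dsimp only at hx1 hx2 hx3 hx4
    have : FiniteDimensional k (Rd k 5 d ⊓ cfgK σ L : Submodule k _) :=
      Submodule.finiteDimensional_of_le inf_le_left
    have : FiniteDimensional k (Rd k 5 (d - 1) ⊓ cfgK σ L : Submodule k _) :=
      Submodule.finiteDimensional_of_le inf_le_left
    obtain ⟨c, hc⟩ := exists_points (Rd k 5 d ⊓ cfgK σ L : Submodule k _)
      (fun p : Fin 4 → k => evL (emb p)) (by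
        rw [eq_bot_iff]
        rintro F ⟨⟨hF1, hF2⟩, hF3⟩
        have hF3' : ∀ p, eval (emb p) F = 0 := fun p => by
          have := (Submodule.mem_iInf _).1 hF3 p
          rwa [LinearMap.mem_ker, evL_apply] at this
        obtain ⟨e, rfl⟩ := Nat.exists_eq_add_of_le hd
        obtain ⟨G, hG, rfl⟩ := X0_div hF1 (rho_zero hF3')
        have hG2 := cfgK_resid hx3 hx4 hF2
        have hb := Submodule.finrank_eq_zero.1 (Nat.le_zero.1 hx2)
        have : G ∈ (Rd k 5 (1 + e - 1) ⊓ cfgK σ L : Submodule k _) := by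
          refine ⟨?_, hG2⟩
          rwa [Nat.add_sub_cancel_left]
        rw [hb, Submodule.mem_bot] at this
        simp [this]) (Fin a)
    refine ⟨σ, L, c, ?_⟩
    rw [← inf_assoc]
    refine hc.trans ?_
    simp [hx1]

/-- trace conditions coming from the part not in the hyperplane -/
noncomputable def ptK {ι κ : Type} (σ : ι → Fin 4 → Fin 5 → k) (L : κ → Fin 2 → Fin 5 → k) :
    Submodule k (MvPolynomial (Fin 4) k) :=
  (⨅ i, (LinearMap.ker (evL (pt (σ i 0) (σ i 1))) ⊓ LinearMap.ker (evL (pt (σ i 0) (σ i 2))))) ⊓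
    ⨅ j, LinearMap.ker (evL (pt (L j 0) (L j 1)))

/-- conics in the hyperplane -/
noncomputable def conK {ι : Type} (A : ι → Fin 4 → Fin 4 → k) :
    Submodule k (MvPolynomial (Fin 4) k) :=
  ⨅ i, (lineK (A i 0) (A i 1) ⊓ lineK (A i 0) (A i 2))

lemma step_trace {d s l a b e M : ℕ} (h3 : Cfg k 4 (a + b) e d M) :
    ∃ (σ : Fin s → Fin 4 → Fin 5 → k) (L : Fin l → Fin 2 → Fin 5 → k)
      (A : Fin a → Fin 4 → Fin 4 → k) (B : Fin b → Fin 4 → Fin 4 → k)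
      (L' : Fin e → Fin 2 → Fin 4 → k), 
      Module.finrank k (Rd k 4 d ⊓ (conK A ⊓ cfgK B L' ⊓ ptK σ L) :
        Submodule k (MvPolynomial (Fin 4) k)) ≤ M + a - (2 * s + l) := by
  obtain ⟨τ, L', h⟩ := h3
  let A : Fin a → Fin 4 → Fin 4 → k := fun i => τ (Fin.castAdd b i)
  let B : Fin b → Fin 4 → Fin 4 → k := fun i => τ (Fin.natAdd a i)
  have : FiniteDimensional k (Rd k 4 d ⊓ (conK A ⊓ cfgK B L') : Submodule k _) :=
    Submodule.finiteDimensional_of_le inf_le_left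
  have : FiniteDimensional k (Rd k 4 d ⊓ cfgK τ L' : Submodule k _) :=
    Submodule.finiteDimensional_of_le inf_le_left
  have h4 := finrank_le_add_card (Rd k 4 d ⊓ (conK A ⊓ cfgK B L') : Submodule k _)
    (fun i : Fin a => dvL (A i 0) (A i 3))
  have h5 : (Rd k 4 d ⊓ (conK A ⊓ cfgK B L')) ⊓ ⨅ i, LinearMap.ker (dvL (A i 0) (A i 3)) ≤
      Rd k 4 d ⊓ cfgK τ L' := by
    rintro F ⟨⟨hF1, hF2, hF3⟩, hF4⟩
    refine ⟨hF1, (Submodule.mem_iInf _).2 fun i => ?_, hF3.2⟩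
    refine Fin.addCases (fun i => ?_) (fun i => ?_) i
    · exact ⟨(Submodule.mem_iInf _).1 hF2 i, (Submodule.mem_iInf _).1 hF4 i⟩
    · exact (Submodule.mem_iInf _).1 hF3.1 i
  have h6 := Submodule.finrank_mono h5
  obtain ⟨c, hc⟩ := exists_points (Rd k 4 d ⊓ (conK A ⊓ cfgK B L') : Submodule k _)
    (fun p : Fin 4 → k => evL p) (by
      rw [eq_bot_iff]
      rintro F ⟨_, hF3⟩
      rw [Submodule.mem_bot]
      apply MvPolynomial.funext
      intro p
      have := (Submodule.mem_iInf _).1 hF3 p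
      rwa [LinearMap.mem_ker, evL_apply] at this) ((Fin s × Fin 2) ⊕ Fin l)
  refine ⟨fun i => ![e0 k, emb (c (Sum.inl (i, 0))), emb (c (Sum.inl (i, 1))), 0],
    fun j => ![e0 k, emb (c (Sum.inr j))], A, B, L', ?_⟩
  have h7 : (Rd k 4 d ⊓ (conK A ⊓ cfgK B L' ⊓ 
      ptK (fun i : Fin s => ![e0 k, emb (c (Sum.inl (i, 0))), emb (c (Sum.inl (i, 1))), 0])
        (fun j : Fin l => ![e0 k, emb (c (Sum.inr j))])) : Submodule k _) ≤
      (Rd k 4 d ⊓ (conK A ⊓ cfgK B L') ⊓ ⨅ i, LinearMap.ker (evL (c i)) : Submodule k _) := by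
    rw [← inf_assoc]
    refine inf_le_inf_left _ (le_iInf fun i => ?_)
    rcases i with ⟨i, j⟩ | j
    · refine inf_le_left.trans ((iInf_le _ i).trans ?_)
      fin_cases j
      · refine inf_le_left.trans ?_
        simp [pt_e0]
      · refine inf_le_right.trans ?_
        simp [pt_e0]
    · refine inf_le_right.trans ((iInf_le _ j).trans ?_)
      simp [pt_e0]
  have : FiniteDimensional k ((Rd k 4 d ⊓ (conK A ⊓ cfgK B L') ⊓ ⨅ i, LinearMap.ker (evL (c i)) :
    Submodule k _)) := Submodule.finiteDimensional_of_le inf_le_left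
  refine (Submodule.finrank_mono h7).trans (hc.trans ?_)
  simp at h4 ⊢
  omega
end P4


section P4Step
variable {k : Type} [Field k] [Infinite k]

lemma step4 {d s l a b e M : ℕ} (h1 : Cfg k 5 s l d a)
    (h2 : a = 0 ∨ (1 ≤ d ∧ Cfg k 5 s l (d - 1) 0)) (h3 : Cfg k 4 (a + b) e (1 + d) M) :
    Cfg k 5 (s + (a + b)) (l + e) (1 + d) (M + a - (2 * s + l)) := by
  let E := (Fin s → Fin 4 → Fin 5 → k) × (Fin l → Fin 2 → Fin 5 → k) ×
    (Fin a → Fin 4 → Fin 4 → k) × (Fin b → Fin 4 → Fin 4 → k) × (Fin e → Fin 2 → Fin 4 → k)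
  have p1 : ∀ j a i, PolyFn (fun x : E => x.1 j a i) := fun j a i =>
    fun x y => polyFn_coord j a i x.1 y.1
  have p2 : ∀ j a i, PolyFn (fun x : E => x.2.1 j a i) := fun j a i =>
    fun x y => polyFn_coord j a i x.2.1 y.2.1
  have p3 : ∀ j a i, PolyFn (fun x : E => x.2.2.1 j a i) := fun j a i =>
    fun x y => polyFn_coord j a i x.2.2.1 y.2.2.1
  have p4 : ∀ j a i, PolyFn (fun x : E => x.2.2.2.1 j a i) := fun j a i =>
    fun x y => polyFn_coord j a i x.2.2.2.1 y.2.2.2.1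
  have p5 : ∀ j a i, PolyFn (fun x : E => x.2.2.2.2 j a i) := fun j a i =>
    fun x y => polyFn_coord j a i x.2.2.2.2 y.2.2.2.2
  have hpt : ∀ {u v : E → Fin 5 → k}, (∀ i, PolyFn (fun x => u x i)) →
      (∀ i, PolyFn (fun x => v x i)) → ∀ i, PolyFn (fun x => pt (u x) (v x) i) := by
    intro u v hu hv i
    exact ((hu 0).mul (hv i.succ)).sub ((hv 0).mul (hu i.succ))
  have hemb : ∀ {u : E → Fin 4 → k}, (∀ i, PolyFn (fun x => u x i)) →
      ∀ i, PolyFn (fun x => emb (u x) i) := by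
    intro u hu i
    refine Fin.cases ?_ (fun i => ?_) i
    · exact PolyFn.const 0
    · exact hu i
  have K1 : AlgFam (fun x : E => cfgK x.1 x.2.1 ⊓
      ⨅ i, LinearMap.ker (evL (emb (x.2.2.1 i 0)))) :=
    (algFam_cfg p1 p2).inf (AlgFam.iInf fun i => algFam_ev (hemb (p3 i 0)))
  have K2 : AlgFam (fun x : E => conK x.2.2.1 ⊓ cfgK x.2.2.2.1 x.2.2.2.2 ⊓ ptK x.1 x.2.1) := by
    refine AlgFam.inf (AlgFam.inf ?_ (algFam_cfg p4 p5)) (AlgFam.inf ?_ ?_)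
    · exact AlgFam.iInf fun i => (algFam_line (p3 i 0) (p3 i 1)).inf (algFam_line (p3 i 0) (p3 i 2))
    · exact AlgFam.iInf fun i => (algFam_ev (hpt (p1 i 0) (p1 i 1))).inf
        (algFam_ev (hpt (p1 i 0) (p1 i 2)))
    · exact AlgFam.iInf fun i => (algFam_ev (hpt (p2 i 0) (p2 i 1)))
  have o1 := op_ker (Rd k 5 d) K1 0
  have o2 := op_ker (Rd k 4 (1 + d)) K2 (M + a - (2 * s + l))
  have o3 : Op k (fun x : E => (∀ i, x.1 i 0 0 ≠ 0) ∧ (∀ j, x.2.1 j 0 0 ≠ 0)) :=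
    (Op.all fun i => Op.ne_zero (p1 i 0 0)).and (Op.all fun i => Op.ne_zero (p2 i 0 0))
  obtain ⟨⟨σ, L, A, B, L'⟩, hx1, hx2, hx3, hx4⟩ := Op.exists_and o1 (o2.and o3)
    (by
      obtain ⟨σ, L, c, h⟩ := step_resid h1 h2
      exact ⟨(σ, L, fun i _ => c i, fun _ _ _ => 0, fun _ _ _ => 0), h⟩)
    (Op.exists_and o2 o3
      (by
        obtain ⟨σ, L, A, B, L', h⟩ := step_trace (s := s) (l := l) h3
        exact ⟨(σ, L, A, B, L'), h⟩)
      ⟨(fun _ _ _ => 1, fun _ _ _ => 1, 0, 0, 0), by simp⟩)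
  dsimp only at hx1 hx2 hx3 hx4
  refine Cfg.of_types (ι := Fin s ⊕ (Fin a ⊕ Fin b)) (κ := Fin l ⊕ Fin e) (by simp) (by simp)
    (Sum.elim σ (Sum.elim (fun i => ![emb (A i 0), emb (A i 1), emb (A i 2), e0 k])
      (fun i j => emb (B i j)))) (Sum.elim L (fun i j => emb (L' i j))) ?_
  set W : Submodule k (MvPolynomial (Fin 5) k) := Rd k 5 (1 + d) ⊓ cfgK _ _ with hW
  have hWd : ∀ F ∈ W, F ∈ Rd k 5 (1 + d) := fun F hF => hF.1
  have hW1 : ∀ F ∈ W, F ∈ cfgK σ L := fun F hF =>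
    ⟨(Submodule.mem_iInf _).2 fun i => (Submodule.mem_iInf _).1 hF.2.1 (Sum.inl i),
      (Submodule.mem_iInf _).2 fun i => (Submodule.mem_iInf _).1 hF.2.2 (Sum.inl i)⟩
  have hWA : ∀ F ∈ W, ∀ i, F ∈ sunK ![emb (A i 0), emb (A i 1), emb (A i 2), e0 k] :=
    fun F hF i => (Submodule.mem_iInf _).1 hF.2.1 (Sum.inr (Sum.inl i))
  have hWB : ∀ F ∈ W, ∀ i, F ∈ sunK (fun j => emb (B i j)) :=
    fun F hF i => (Submodule.mem_iInf _).1 hF.2.1 (Sum.inr (Sum.inr i))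
  have hWL : ∀ F ∈ W, ∀ i, F ∈ lineK (emb (L' i 0)) (emb (L' i 1)) :=
    fun F hF i => (Submodule.mem_iInf _).1 hF.2.2 (Sum.inr i)
  have : FiniteDimensional k W := Submodule.finiteDimensional_of_le inf_le_left
  set K' : Submodule k (MvPolynomial (Fin 5) k) := Rd k 5 d ⊓ (cfgK σ L ⊓
      ⨅ i, LinearMap.ker (evL (emb (A i 0)))) with hK'
  have : FiniteDimensional k K' := Submodule.finiteDimensional_of_le inf_le_left
  refine (finrank_split W K' (rho k).toLinearMap (LinearMap.mulLeft k (X 0)) ?_).trans ?_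
  · rintro F ⟨hF, hF0⟩
    obtain ⟨G, hG, rfl⟩ := X0_div (hWd F hF) hF0
    refine ⟨G, ⟨hG, cfgK_resid hx3 hx4 (hW1 _ hF), ?_⟩, by simp⟩
    refine (Submodule.mem_iInf _).2 fun i => ?_
    have h : dvL (emb (A i 0)) (e0 k) (X 0 * G) = 0 := (hWA _ hF i).2
    rw [dvL_mul, dvL_X, eval_X] at h
    rw [LinearMap.mem_ker, evL_apply]
    simpa [emb, e0] using h
  have hle : W.map (rho k).toLinearMap ≤
      Rd k 4 (1 + d) ⊓ (conK A ⊓ cfgK B L' ⊓ ptK σ L) := by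
    rintro _ ⟨F, hF, rfl⟩
    have hline : ∀ {u v : Fin 5 → k}, F ∈ lineK u v →
        (rho k).toLinearMap F ∈ LinearMap.ker (evL (pt u v)) := by
      intro u v h
      rw [LinearMap.mem_ker, evL_apply, AlgHom.toLinearMap_apply, eval_rho, emb_pt]
      exact mem_lineK.1 h _ _
    refine ⟨rho_mem (hWd F hF), ⟨?_, ?_, ?_⟩, ?_, ?_⟩
    · refine (Submodule.mem_iInf _).2 fun i => ?_
      exact ⟨lineK_emb (hWA F hF i).1.1, lineK_emb (hWA F hF i).1.2⟩
    · refine (Submodule.mem_iInf _).2 fun i => ?_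
      refine ⟨⟨lineK_emb (hWB F hF i).1.1, lineK_emb (hWB F hF i).1.2⟩, ?_⟩
      have h : dvL (emb (B i 0)) (emb (B i 3)) F = 0 := (hWB F hF i).2
      rw [← dvL_rho] at h
      exact h
    · exact (Submodule.mem_iInf _).2 fun i => lineK_emb (hWL F hF i)
    · refine (Submodule.mem_iInf _).2 fun i => ?_
      have h := (Submodule.mem_iInf _).1 (hW1 F hF).1 i
      exact ⟨hline h.1.1, hline h.1.2⟩
    · exact (Submodule.mem_iInf _).2 fun i => hline ((Submodule.mem_iInf _).1 (hW1 F hF).2 i)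
  have : FiniteDimensional k (Rd k 4 (1 + d) ⊓ (conK A ⊓ cfgK B L' ⊓ ptK σ L) : Submodule k _) :=
    Submodule.finiteDimensional_of_le inf_le_left
  have h7 := Submodule.finrank_mono hle
  omega
end P4Step


lemma four_choose (D : ℕ) : 4 * (D + 4).choose 4 = (D + 4).choose 3 * (D + 1) := by
  have := Nat.choose_succ_right_eq (D + 4) 3
  rw [show D + 4 - 3 = D + 1 by omega] at this
  linarith

lemma four_choose' (D : ℕ) : 4 * (D + 3).choose 4 = (D + 3).choose 3 * D := by
  have := Nat.choose_succ_right_eq (D + 3) 3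
  rw [show D + 3 - 3 = D by omega] at this
  linarith

lemma two_choose (D : ℕ) : (D + 3).choose 2 * 2 = (D + 3) * (D + 2) := by
  have := Nat.add_one_mul_choose_eq (D + 2) 1
  simp at this
  linarith

lemma choose_43 (D : ℕ) : (D + 4).choose 3 = (D + 3).choose 2 + (D + 3).choose 3 :=
  Nat.choose_succ_succ' _ _

lemma choose_44 (D : ℕ) : (D + 4).choose 4 = (D + 3).choose 3 + (D + 3).choose 4 :=
  Nat.choose_succ_succ' _ _

def TT (d : ℕ) : ℕ := (d + 4).choose 4 / (d + 1)
def TS (d : ℕ) : ℕ := ((d + 4).choose 4 + d) / (d + 1)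

/-- being within rounding of the quotient -/
def Near (D τ : ℕ) : Prop :=
  τ * (D + 1) ≤ (D + 4).choose 4 + D ∧ (D + 4).choose 4 ≤ τ * (D + 1) + D

lemma near_TT (D : ℕ) : Near D (TT D) := by
  unfold TT
  have h1 := Nat.div_add_mod ((D + 4).choose 4) (D + 1)
  have h2 := Nat.mod_lt ((D + 4).choose 4) (show 0 < D + 1 by omega)
  rw [mul_comm] at h1
  constructor <;> omega

lemma near_TS (D : ℕ) : Near D (TS D) := by
  unfold TS
  have h1 := Nat.div_add_mod ((D + 4).choose 4 + D) (D + 1)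
  have h2 := Nat.mod_lt ((D + 4).choose 4 + D) (show 0 < D + 1 by omega)
  rw [mul_comm] at h1
  constructor <;> omega

lemma TS_ge (D : ℕ) : (D + 4).choose 4 ≤ TS D * (D + 1) := by
  unfold TS
  have h1 := Nat.div_add_mod ((D + 4).choose 4 + D) (D + 1)
  have h2 := Nat.mod_lt ((D + 4).choose 4 + D) (show 0 < D + 1 by omega)
  nlinarith

lemma TT_le (D : ℕ) : TT D * (D + 1) ≤ (D + 4).choose 4 := Nat.div_mul_le_self _ _

lemma Near.bd {D τ : ℕ} (h : Near D τ) :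
    4 * τ ≤ (D + 4).choose 3 + 3 ∧ (D + 4).choose 3 ≤ 4 * τ + 3 := by
  obtain ⟨h1, h2⟩ := h
  have h3 := four_choose D
  constructor
  · by_contra hc
    push Not at hc
    nlinarith [Nat.mul_le_mul_right (D + 1) (show (D + 4).choose 3 + 4 ≤ 4 * τ by omega)]
  · by_contra hc
    push Not at hc
    nlinarith [Nat.mul_le_mul_right (D + 1) (show 4 * τ + 4 ≤ (D + 4).choose 3 by omega)]

lemma TT_zero : TT 0 = 1 := by decide
lemma TS_zero : TS 0 = 1 := by decide

lemma remainder (D : ℕ) (a : ℕ) (ha : a + TT D * (D + 1) = (D + 4).choose 4) :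
    4 * a ≤ 3 * (D + 1) ∧ 4 * TT D ≤ (D + 4).choose 3 := by
  have h3 := four_choose D
  have h4 := (near_TT D).bd.2
  have h5 := TT_le D
  constructor
  · nlinarith
  · by_contra hc
    push Not at hc
    nlinarith [Nat.mul_le_mul_right (D + 1) (show (D + 4).choose 3 + 1 ≤ 4 * TT D by omega)]

set_option maxHeartbeats 4000000 in
lemma arith_small {d τ a s : ℕ} (hd : 1 ≤ d) (hd7 : d ≤ 7) (ha : a + TT d * (d + 1) = (d + 4).choose 4)
    (hτ : Near (d + 1) τ) (hs : (a = 0 ∧ s = 1) ∨ (0 < a ∧ s = a)) :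
    ∃ n K, n + K + TT d = τ ∧ s ≤ n ∧ s ≤ K ∧ K ≤ d + 2 ∧ n ≤ fq (d - 1) ∧
      2 * n ≤ (d + 2) * (d + 2 - K) ∧ s ≤ d ∧ 2 * (d - s) ≤ TT d ∧ a ≤ TT d := by
  refine ⟨τ - TT d - max s (τ - TT d - fq (d - 1)), max s (τ - TT d - fq (d - 1)), ?_⟩
  obtain ⟨h5, h6⟩ := hτ
  interval_cases d <;> simp only [TT, fq, Nat.choose] at * <;> norm_num at * <;> omega

set_option maxHeartbeats 4000000 in
/-- the numerical facts for the inductive step, `D = d + 1` -/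
lemma arith {d τ a s : ℕ} (hd : 1 ≤ d) (ha : a + TT d * (d + 1) = (d + 4).choose 4)
    (hτ : Near (d + 1) τ) (hs : (a = 0 ∧ s = 1) ∨ (0 < a ∧ s = a)) :
    ∃ n K, n + K + TT d = τ ∧ s ≤ n ∧ s ≤ K ∧ K ≤ d + 2 ∧ n ≤ fq (d - 1) ∧
      2 * n ≤ (d + 2) * (d + 2 - K) ∧ s ≤ d ∧ 2 * (d - s) ≤ TT d ∧ a ≤ TT d := by
  obtain ⟨h1, h2⟩ := remainder d a ha
  have h3 := (near_TT d).bd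
  have h4 := hτ.bd
  by_cases hd7 : d ≤ 7
  · exact arith_small hd hd7 ha hτ hs
  push Not at hd7
  obtain ⟨e, rfl⟩ : ∃ e, d = e + 8 := ⟨d - 8, by omega⟩
  have c1 := choose_43 (e + 9)
  have c2 := two_choose (e + 9)
  have c3 := six_choose (e + 10)
  have f1 : 8 * fq (e + 8 - 1) ≤ (e + 9) * (e + 10) + 8 ∧ (e + 9) * (e + 10) + 1 ≤ 8 * fq (e + 8 - 1) := by
    unfold fq
    rw [show e + 8 - 1 + 2 = e + 9 by omega, show e + 8 - 1 + 3 = e + 10 by omega]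
    have := Nat.div_add_mod ((e + 9) * (e + 10)) 8
    have := Nat.mod_lt ((e + 9) * (e + 10)) (show 0 < 8 by omega)
    omega
  generalize fq (e + 8 - 1) = f at *
  generalize TT (e + 8) = t at *
  simp only [show e + 8 + 1 + 4 = e + 13 by ring, show e + 9 + 4 = e + 13 by ring,
    show e + 9 + 3 = e + 12 by ring, show e + 8 + 4 = e + 12 by ring,
    show e + 10 + 2 = e + 12 by ring, show e + 9 + 2 = e + 11 by ring] at *
  obtain ⟨x, hx⟩ : ∃ x, x = e * e := ⟨_, rfl⟩
  have c2' : (e + 12).choose 2 * 2 = x + 23 * e + 132 := by rw [c2, hx]; ring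
  have c3' : 12 * (x + 21 * e + 110) ≤ 6 * (e + 12).choose 3 := by rw [c3, hx]; nlinarith
  have f2 : (e + 9) * (e + 10) = x + 19 * e + 90 := by rw [hx]; ring
  have c4 : 8 * t + (x + 23 * e + 132) ≤ 8 * τ + 6 := by omega
  have c5 : 8 * τ ≤ 8 * t + (x + 23 * e + 132) + 12 := by omega
  rw [f2] at f1
  obtain ⟨K, hK⟩ : ∃ K, K = max s (τ - t - f) := ⟨_, rfl⟩
  obtain ⟨n, hn⟩ : ∃ n, n = τ - t - K := ⟨_, rfl⟩
  have k1 : K ≤ e + 10 := by omega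
  have k2 : n ≤ f := by omega
  have k3 : 8 * K ≤ 6 * (e + 9) := by omega
  refine ⟨n, K, by omega, by omega, by omega, by omega, by omega, ?_, by omega, by omega, by omega⟩
  obtain ⟨y, hy⟩ : ∃ y, y = e + 10 - K := ⟨_, rfl⟩
  rw [show e + 8 + 2 = e + 10 by ring, ← hy]
  have : 2 * e + 26 ≤ 8 * y := by omega
  have := Nat.mul_le_mul_left (e + 10) this
  nlinarith

lemma TT_ge (d : ℕ) : 2 * (d - 1) ≤ TT d := by
  have h3 := (near_TT d).bd.2
  by_cases hd : d ≤ 3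
  · interval_cases d <;> simp [TT, Nat.choose]
  have c1 := choose_43 d
  have c2 := two_choose d
  have c3 := six_choose (d + 1)
  obtain ⟨e, rfl⟩ : ∃ e, d = e + 4 := ⟨d - 4, by omega⟩
  simp only [show e + 4 + 1 + 2 = e + 4 + 3 by ring] at *
  rw [show 2 * (e + 4 - 1) = 2 * e + 6 by omega]
  have c4 : 30 * (e + 4 + 3) ≤ 6 * (e + 4 + 3).choose 3 := by rw [c3]; nlinarith
  have c5 : 6 * (e + 4 + 3) ≤ 2 * (e + 4 + 3).choose 2 := by rw [mul_comm 2, c2]; nlinarith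
  omega

lemma TT_le_TS (d : ℕ) : TT d ≤ TS d := Nat.div_le_div_right (by omega)

lemma TS_add_two (d : ℕ) : TS (d + 1) + 2 ≤ TT (d + 2) := by
  have h3 := (near_TT (d + 2)).bd.2
  have h4 := (near_TS (d + 1)).bd.1
  by_cases hd : d = 0
  · subst hd; simp [TT, TS, Nat.choose]
  have c1 := choose_43 (d + 2)
  have c2 := two_choose (d + 2)
  simp only [show d + 1 + 4 = d + 2 + 3 by ring] at *
  have : 6 * 5 ≤ (d + 2 + 3) * (d + 2 + 2) := Nat.mul_le_mul (by omega) (by omega)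
  omega

section
variable {k : Type} [Field k] [Infinite k]

def AA (k : Type) [Field k] (d : ℕ) : Prop :=
  ∀ τ, Near d τ → Cfg k 5 (d - 1) (τ - 2 * (d - 1)) d ((d + 4).choose 4 - τ * (d + 1))

lemma aa_zero : AA k 0 := by
  intro τ hτ
  have : τ = 1 := by obtain ⟨h1, h2⟩ := hτ; simp at h1 h2; omega
  subst this
  refine ⟨fun i => 0, fun i j => 0, ?_⟩
  simp only [Nat.le_zero_eq, Nat.choose, Nat.sub_self, mul_one, zero_add]
  have : (Rd k 5 0 ⊓ cfgK (fun _ : Fin 0 => (0 : Fin 4 → Fin 5 → k))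
      (fun (_ : Fin (1 - 2 * 0)) (_ : Fin 2) => (0 : Fin 5 → k))) = ⊥ := by
    rw [eq_bot_iff]
    rintro F ⟨h1, h2⟩
    have h3 := (Submodule.mem_iInf _).1 h2.2 ⟨0, by simp⟩
    have h4 := mem_lineK.1 h3 0 0
    have h5 : F.totalDegree = 0 := Nat.le_zero.1 ((mem_homogeneousSubmodule _ _).1 h1).totalDegree_le
    rw [totalDegree_eq_zero_iff_eq_C] at h5
    rw [h5] at h4 ⊢
    simp at h4
    simp [h4]
  erw [this]
  simp

lemma aa_one (h0 : AA k 0) : AA k 1 := by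
  intro τ hτ
  have hτ' : τ = 2 ∨ τ = 3 := by
    obtain ⟨h1, h2⟩ := hτ; simp [Nat.choose] at h1 h2; omega
  have h1 : Cfg k 5 0 1 0 0 := h0 1 ⟨by simp, by simp⟩
  have h3 : Cfg k 4 0 (τ - 1) 1 (4 - (τ - 1) * 2) := by
    have := p3 (k := k) (d := 1) (s := 0) (n := 0) (K := τ - 1) (by omega) (by omega) (by omega)
      (by omega) (by omega) (by omega)
    simpa [Nat.choose] using this
  have := step4 (a := 0) (b := 0) h1 (Or.inl rfl) h3
  refine this.mono (by omega) (by omega) ?_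
  simp [Nat.choose]
  omega

lemma aa_step (d : ℕ) (hd : 1 ≤ d) (h1 : AA k d) (h0 : AA k (d - 1)) : AA k (d + 1) := by
  intro τ hτ
  obtain ⟨a, ha⟩ : ∃ a, a + TT d * (d + 1) = (d + 4).choose 4 :=
    ⟨_, Nat.sub_add_cancel (TT_le d)⟩
  obtain ⟨b, hb⟩ : ∃ b, (a = 0 ∧ b = 1) ∨ (0 < a ∧ b = 0) := by
    rcases Nat.eq_zero_or_pos a with h | h
    · exact ⟨1, Or.inl ⟨h, rfl⟩⟩
    · exact ⟨0, Or.inr ⟨h, rfl⟩⟩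
  obtain ⟨n, K, e1, e2, e3, e4, e5, e6, e7, e8, e9⟩ :=
    arith (s := a + b) hd ha hτ (by omega)
  have g1 := h1 (TT d) (near_TT d)
  rw [← ha, Nat.add_sub_cancel] at g1
  have tge := TT_ge d
  have g1' : Cfg k 5 (d - (a + b)) (TT d - 2 * (d - (a + b))) d a :=
    (g1.to_lines (d - (a + b)) (by omega)).mono le_rfl (by omega) le_rfl
  have g3 := p3 (k := k) (d := 1 + d) (s := a + b) (n := n) (K := K) e2 e3 (by omega)
    (fun _ => by rwa [show 1 + d - 2 = d - 1 by omega]) (by omega)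
    (by rwa [show 1 + d + 1 = d + 2 by omega])
  have g2 : a = 0 ∨ (1 ≤ d ∧ Cfg k 5 (d - (a + b)) (TT d - 2 * (d - (a + b))) (d - 1) 0) := by
    rcases Nat.eq_zero_or_pos a with h | h
    · exact Or.inl h
    refine Or.inr ⟨hd, ?_⟩
    have hb0 : b = 0 := by omega
    subst hb0
    have z := h0 (TS (d - 1)) (near_TS _)
    have zz := TS_ge (d - 1)
    rw [Nat.sub_eq_zero_of_le zz] at z
    have t2 := (TT_ge (d - 1)).trans (TT_le_TS (d - 1))
    rcases Nat.lt_or_ge d 2 with h2 | h2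
    · have : d = 1 := by omega
      subst this
      refine z.mono (by omega) ?_ le_rfl
      simp [TS_zero]
      have : TT 1 = 2 := by decide
      omega
    · have t3 := TS_add_two (d - 2)
      rw [show d - 2 + 1 = d - 1 by omega, show d - 2 + 2 = d by omega] at t3
      rcases Nat.lt_or_ge a 2 with h3 | h3
      · exact z.mono (by omega) (by omega) le_rfl
      · exact (z.to_lines (d - (a + 0)) (by omega)).mono le_rfl (by omega) le_rfl
  have := step4 g1' g2 g3
  rw [show 1 + d = d + 1 by ring] at this
  refine this.mono (by omega) (by omega) ?_
  have c := choose_44 (d + 1)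
  rw [show d + 1 + 3 = d + 4 by ring, ← ha] at c
  rw [c, show d + 1 + 3 = d + 4 by ring]
  have e : τ * (d + 1 + 1) = (n + K) * (d + 1 + 1) + TT d * (d + 1) + TT d := by
    rw [← e1]; ring
  rw [e]
  omega

lemma aa (d : ℕ) : AA k d ∧ AA k (d + 1) := by
  induction d with
  | zero => exact ⟨aa_zero, aa_one aa_zero⟩
  | succ d ih => exact ⟨ih.2, aa_step (d + 1) (by omega) ih.2 (by simpa using ih.1)⟩

end

section
variable {k : Type} [Field k]

lemma finrank_Rd (n d : ℕ) : Module.finrank k (Rd k (n + 1) d) = (d + n).choose n := by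
  unfold Rd
  rw [homogeneousSubmodule_eq_finsupp_supported]
  rw [LinearEquiv.finrank_eq (AddMonoidAlgebra.supportedEquivFinsupp _)]
  have e : {c : Fin (n + 1) →₀ ℕ | c.degree = d} ≃ Sym (Fin (n + 1)) d := 
    (Equiv.subtypeEquivRight (fun c => by simp [Finsupp.degree_eq_sum, Finsupp.sum_fintype])).trans (Sym.equivNatSum (Fin (n + 1)) d).symm
  rw [LinearEquiv.finrank_eq (Finsupp.domLCongr e), Module.finrank_finsupp_self, Sym.card_sym_eq_choose]
  simp
  rw [add_comm n d, Nat.choose_symm_add]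

lemma dvL_of_line [Infinite k] {n : ℕ} {P w : Fin n → k} {F} (h : ∀ c : k, eval (P + c • w) F = 0) :
    dvL P w F = 0 := by
  have : lineP P w F = 0 := Polynomial.funext fun c => by rw [eval_lineP, h]; simp
  rw [dvL_apply, this]; simp

lemma dvL_pderiv {n : ℕ} (P w : Fin n → k) (F) : dvL P w F = ∑ i, w i * eval P (pderiv i F) := by
  induction F using MvPolynomial.induction_on with
  | C a => simp [dvL_C]
  | add f g hf hg => simp [hf, hg, mul_add, Finset.sum_add_distrib]
  | mul_X f i hf =>
    simp only [dvL_mul, dvL_X, hf, eval_X, Derivation.leibniz, pderiv_X, smul_eq_mul, map_add,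
      map_mul, mul_add, Finset.sum_add_distrib, Finset.sum_mul]
    congr 1
    · rw [Finset.sum_eq_single i]
      · simp [mul_comm]
      · intro j _ hj; simp [Pi.single_apply, hj.symm]
      · simp
    · exact Finset.sum_congr rfl fun j _ => by ring

lemma taylor {A : Type*} [CommRing A] [Algebra k A] {n : ℕ} (J : Ideal A) (p y : Fin n → A)
    (hy : ∀ i, y i ∈ J) (F : MvPolynomial (Fin n) k) :
    aeval (fun i => p i + y i) F - (aeval p F + ∑ i, y i * aeval p (pderiv i F)) ∈ J ^ 2 := by
  induction F using MvPolynomial.induction_on with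
  | C a => simp
  | add f g hf hg =>
    convert add_mem hf hg using 1
    simp only [map_add, mul_add, Finset.sum_add_distrib]
    ring
  | mul_X f j hf =>
    have h1 : (∑ i, y i * aeval p (pderiv i (f * X j)))
        = aeval p f * y j + (∑ i, y i * aeval p (pderiv i f)) * p j := by
      simp only [Derivation.leibniz, pderiv_X, smul_eq_mul, map_add,
        map_mul, mul_add, Finset.sum_add_distrib, Finset.sum_mul]
      congr 1
      · rw [Finset.sum_eq_single j]
        · simp [mul_comm]
        · intro i _ hj; simp [Pi.single_apply, hj.symm]
        · simp
      · exact Finset.sum_congr rfl fun j _ => by simp; ring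
    have h2 : (∑ i, y i * aeval p (pderiv i f)) ∈ J :=
      sum_mem fun i _ => J.mul_mem_right _ (hy i)
    have h3 : (∑ i, y i * aeval p (pderiv i f)) * y j ∈ J ^ 2 := by
      rw [pow_two]; exact Ideal.mul_mem_mul h2 (hy j)
    rw [h1]
    convert add_mem ((J ^ 2).mul_mem_right (p j + y j) hf) h3 using 1
    simp only [map_mul, aeval_X]
    ring

lemma vanIdeal_mem {n : ℕ} {V : Set (Fin n → k)} {F} : F ∈ vanIdeal k n V ↔ ∀ v ∈ V, eval v F = 0 :=
  Iff.rfl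

lemma mem_van_pair {n : ℕ} {u v : Fin n → k} {F} :
    F ∈ vanIdeal k n (Submodule.span k {u, v} : Submodule k (Fin n → k)) ↔ F ∈ lineK u v := by
  rw [mem_lineK, vanIdeal_mem]
  constructor
  · intro h a b
    exact h _ (Submodule.mem_span_pair.2 ⟨a, b, rfl⟩)
  · rintro h v hv
    obtain ⟨a, b, rfl⟩ := Submodule.mem_span_pair.1 hv
    exact h a b

lemma dv_of_mem [Infinite k] {n : ℕ} {V T : Submodule k (Fin n → k)} {P w : Fin n → k} (hP : P ∈ V) (hPT : P ∈ T)
    (hw : w ∈ T) {F} (hF : F ∈ vanIdeal k n (V : Set (Fin n → k)) ^ 2 + vanIdeal k n (T : Set (Fin n → k))) :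
    dvL P w F = 0 := by
  obtain ⟨G, hG, H, hH, rfl⟩ := Submodule.mem_sup.1 hF
  rw [map_add]
  have h1 : dvL P w H = 0 := dvL_of_line fun c => hH _ (T.add_mem hPT (T.smul_mem c hw))
  rw [h1, add_zero]
  rw [pow_two] at hG
  refine Submodule.mul_induction_on hG ?_ ?_
  · intro f hf g hg
    rw [dvL_mul, hf P hP, hg P hP]; simp
  · intro f g hf hg; rw [map_add, hf, hg, add_zero]

lemma aeval_smulC_hom {d n : ℕ} {F : MvPolynomial (Fin n) k} (hF : F ∈ Rd k n d)
    (L : MvPolynomial (Fin n) k) (P : Fin n → k) :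
    aeval (fun i => L * C (P i)) F = L ^ d * C (eval P F) := by
  have e : aeval (fun i => C (P i)) F = (C (eval P F) : MvPolynomial (Fin n) k) := by
    clear hF
    induction F using MvPolynomial.induction_on with
    | C a => simp [algebraMap_eq]
    | add f g hf hg => simp only [map_add, hf, hg]
    | mul_X f i hf => simp only [map_mul, hf, aeval_X, eval_X]
  rw [aeval_smul_hom hF L (fun i => C (P i)), e]

lemma eval_aeval' {n : ℕ} (v : Fin n → k) (f : Fin n → MvPolynomial (Fin n) k) (F) :
    eval v (aeval f F) = eval (fun i => eval v (f i)) F := by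
  induction F using MvPolynomial.induction_on with
  | C a => simp [algebraMap_eq]
  | add f g hf hg => simp only [map_add, hf, hg]
  | mul_X f i hf => simp only [map_mul, hf, aeval_X, eval_X]

set_option maxHeartbeats 1000000 in
lemma mem_of_dv {d n : ℕ} {m : ℕ} {S : Fin (m + 1) → Fin n → k} (hS : LinearIndependent k S)
    {F : MvPolynomial (Fin n) k} (hF : F ∈ Rd k n d) (h0 : eval (S 0) F = 0)
    (hd : ∀ a, dvL (S 0) (S a) F = 0) :
    F ∈ vanIdeal k n (Submodule.span k {S 0} : Submodule k (Fin n → k)) ^ 2 +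
      vanIdeal k n (Submodule.span k (Set.range S) : Submodule k (Fin n → k)) := by
  obtain ⟨g, hg⟩ := LinearMap.exists_leftInverse_of_injective (Fintype.linearCombination k S)
    (LinearMap.ker_eq_bot.2 hS.fintypeLinearCombination_injective)
  have hg' : ∀ c, g (∑ a, c a • S a) = c := fun c => by
    simpa [Fintype.linearCombination_apply] using LinearMap.congr_fun hg c
  let ℓ : Fin (m + 1) → MvPolynomial (Fin n) k := fun a => ∑ i, C (g (Pi.single i 1) a) * X i
  have hℓ : ∀ a v, eval v (ℓ a) = g v a := by
    intro a v
    conv_rhs => rw [pi_eq_sum_univ' v]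
    simp [ℓ, mul_comm]
  have hgS : ∀ a b, g (S b) a = if a = b then 1 else 0 := by
    intro a b
    have := hg' (Pi.single b 1)
    simp [Pi.single_apply] at this
    rw [this, Pi.single_apply]
  set J := vanIdeal k n (Submodule.span k {S 0} : Submodule k (Fin n → k)) with hJ
  let y : Fin n → MvPolynomial (Fin n) k := fun i => ∑ a : Fin m, C (S a.succ i) * ℓ a.succ
  let p : Fin n → MvPolynomial (Fin n) k := fun i => ℓ 0 * C (S 0 i)
  have hℓJ : ∀ a : Fin m, ℓ a.succ ∈ J := by
    intro a v hv
    obtain ⟨c, rfl⟩ := Submodule.mem_span_singleton.1 hv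
    rw [hℓ]
    simp [hgS]
  have hy : ∀ i, y i ∈ J := fun i => sum_mem fun a _ => J.mul_mem_left _ (hℓJ a)
  have ht := taylor J p y hy F
  have e1 : aeval p F = 0 := by
    rw [aeval_smulC_hom hF (ℓ 0) (S 0), h0]; simp
  have e2 : ∑ i, y i * aeval p (pderiv i F) = 0 := by
    have h1 : ∀ i, aeval p (pderiv i F) = ℓ 0 ^ (d - 1) * C (eval (S 0) (pderiv i F)) := by
      intro i
      exact aeval_smulC_hom ((mem_homogeneousSubmodule _ _).2 ((mem_homogeneousSubmodule _ _).1 hF).pderiv) (ℓ 0) (S 0)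
    have h2 : ∑ i, y i * aeval p (pderiv i F)
        = ∑ a : Fin m, ℓ 0 ^ (d - 1) * ℓ a.succ * C (dvL (S 0) (S a.succ) F) := by
      simp only [h1, y, dvL_pderiv, map_sum, map_mul, Finset.mul_sum, Finset.sum_mul]
      rw [Finset.sum_comm]
      exact Finset.sum_congr rfl fun a _ => Finset.sum_congr rfl fun i _ => by ring
    rw [h2]; simp [hd]
  rw [e1, e2] at ht
  simp only [add_zero, sub_zero] at ht
  rw [← add_sub_cancel (aeval (fun i => p i + y i) F) F]
  refine Submodule.add_mem_sup ht ?_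
  intro v hv
  obtain ⟨c, rfl⟩ := (Submodule.mem_span_range_iff_exists_fun k).1 hv
  rw [map_sub, sub_eq_zero]
  rw [eval_aeval']
  congr 2
  funext i
  simp only [p, y, map_add, map_sum, map_mul, hℓ, hg', eval_C]
  rw [Finset.sum_apply, Fin.sum_univ_succ]
  simp [mul_comm]
end

section
variable {k : Type} [Field k]

lemma generic_cfg [Infinite k] {s l d m : ℕ} (h : Cfg k 5 s l d m) :
    ∃ (σ : Fin s → Fin 4 → Fin 5 → k) (L : Fin l → Fin 2 → Fin 5 → k),
      Module.finrank k (Rd k 5 d ⊓ cfgK σ L : Submodule k (MvPolynomial (Fin 5) k)) ≤ m ∧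
      (∀ i, LinearIndependent k (σ i)) ∧ ∀ j, LinearIndependent k (L j) := by
  obtain ⟨σ₀, L₀, h⟩ := h
  let E := (Fin s → Fin 4 → Fin 5 → k) × (Fin l → Fin 2 → Fin 5 → k)
  have p1 : ∀ j a i, PolyFn (fun x : E => x.1 j a i) := fun j a i x y => polyFn_coord j a i x.1 y.1
  have p2 : ∀ j a i, PolyFn (fun x : E => x.2 j a i) := fun j a i x y => polyFn_coord j a i x.2 y.2
  have o1 : Op k (fun x : E => Module.finrank k (Rd k 5 d ⊓ cfgK x.1 x.2 : Submodule k (MvPolynomial (Fin 5) k)) ≤ m) :=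
    op_ker _ (algFam_cfg p1 p2) m
  have o2 : Op k (fun x : E => ∀ i, (Matrix.of fun a b : Fin 4 => x.1 i a (Fin.castLE (by omega) b)).det ≠ 0) :=
    Op.all fun i => Op.ne_zero (PolyFn.det fun a b => p1 i a _)
  have o3 : Op k (fun x : E => ∀ i, (Matrix.of fun a b : Fin 2 => x.2 i a (Fin.castLE (by omega) b)).det ≠ 0) :=
    Op.all fun i => Op.ne_zero (PolyFn.det fun a b => p2 i a _)
  obtain ⟨x, hx1, hx2, hx3⟩ := Op.exists_and o1 (o2.and o3) ⟨(σ₀, L₀), h⟩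
    ⟨(fun _ a => Pi.single (Fin.castLE (by omega) a) 1, fun _ a => Pi.single (Fin.castLE (by omega) a) 1), by
      constructor
      · intro i
        have : (Matrix.of fun a b : Fin 4 => (Pi.single (Fin.castLE (by omega) a) 1 : Fin 5 → k) (Fin.castLE (by omega) b)) = 1 := by
          ext a b
          simp [Pi.single_apply, Matrix.one_apply, eq_comm]
        show Matrix.det _ ≠ 0
        rw [this]; simp
      · intro i
        have : (Matrix.of fun a b : Fin 2 => (Pi.single (Fin.castLE (by omega) a) 1 : Fin 5 → k) (Fin.castLE (by omega) b)) = 1 := by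
          ext a b
          simp [Pi.single_apply, Matrix.one_apply, eq_comm]
        show Matrix.det _ ≠ 0
        rw [this]; simp⟩
  refine ⟨x.1, x.2, hx1, fun i => ?_, fun i => ?_⟩
  · exact LinearIndependent.of_comp (LinearMap.funLeft k k (Fin.castLE (by omega) : Fin 4 → Fin 5))
      (Matrix.linearIndependent_rows_of_det_ne_zero (hx2 i))
  · exact LinearIndependent.of_comp (LinearMap.funLeft k k (Fin.castLE (by omega) : Fin 2 → Fin 5))
      (Matrix.linearIndependent_rows_of_det_ne_zero (hx3 i))

lemma finrank_pair {n : ℕ} {u v : Fin n → k} (h : LinearIndependent k ![u, v]) :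
    Module.finrank k (Submodule.span k {u, v} : Submodule k (Fin n → k)) = 2 := by
  have := finrank_span_eq_card h
  have e : Set.range ![u, v] = {u, v} := by
    ext x
    simp [eq_comm]
    tauto
  rw [e] at this
  simpa using this

lemma sundial_geom {n : ℕ} {S : Fin 4 → Fin n → k} (h : LinearIndependent k S) :
    IsSundial k n (Submodule.span k {S 0, S 1}) (Submodule.span k {S 0, S 2})
      (Submodule.span k (Set.range S)) ∧
    (Submodule.span k {S 0, S 1} ⊓ Submodule.span k {S 0, S 2} : Submodule k (Fin n → k)) =
      Submodule.span k {S 0} := by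
  have h1 : Module.finrank k (Submodule.span k {S 0, S 1} : Submodule k (Fin n → k)) = 2 := by
    apply finrank_pair
    convert h.comp ![0, 1] (by decide) using 1
    ext i j; fin_cases i <;> rfl
  have h2 : Module.finrank k (Submodule.span k {S 0, S 2} : Submodule k (Fin n → k)) = 2 := by
    apply finrank_pair
    convert h.comp ![0, 2] (by decide) using 1
    ext i j; fin_cases i <;> rfl
  have h3 : Module.finrank k (Submodule.span k {S 0, S 1} ⊔ Submodule.span k {S 0, S 2} : Submodule k (Fin n → k)) = 3 := by
    have := finrank_span_eq_card (h.comp ![0, 1, 2] (by decide))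
    rw [Fintype.card_fin] at this
    have e : Set.range (S ∘ ![0, 1, 2]) = {S 0, S 1} ∪ {S 0, S 2} := by
      ext x
      simp [Fin.exists_fin_succ, eq_comm]
      tauto
    rw [e, Submodule.span_union] at this
    exact this
  have h4 := Submodule.finrank_sup_add_finrank_inf_eq (Submodule.span k {S 0, S 1} : Submodule k (Fin n → k)) (Submodule.span k {S 0, S 2})
  have h5 : Module.finrank k (Submodule.span k {S 0, S 1} ⊓ Submodule.span k {S 0, S 2} : Submodule k (Fin n → k)) = 1 := by
    omega
  refine ⟨⟨h1, h2, ?_, h5, ?_, ?_⟩, ?_⟩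
  · intro e
    rw [e, inf_idem] at h5
    omega
  · rw [← Submodule.span_union]
    apply Submodule.span_mono
    rintro x ((rfl | rfl) | (rfl | rfl)) <;> exact Set.mem_range_self _
  · simpa using finrank_span_eq_card h
  · symm
    apply Submodule.eq_of_le_of_finrank_eq
    · rw [Submodule.span_singleton_le_iff_mem]
      exact ⟨Submodule.subset_span (by simp), Submodule.subset_span (by simp)⟩
    · rw [h5, finrank_span_singleton (h.ne_zero 0)]

lemma mem_sundial_iff [Infinite k] {n d : ℕ} {S : Fin 4 → Fin n → k} (h : LinearIndependent k S)
    {F} (hF : F ∈ Rd k n d) :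
    F ∈ sundialIdeal k n (Submodule.span k {S 0, S 1}) (Submodule.span k {S 0, S 2})
      (Submodule.span k (Set.range S)) ↔ F ∈ sunK S := by
  unfold sundialIdeal sunK
  rw [(sundial_geom h).2]
  simp only [Submodule.mem_inf, mem_van_pair, LinearMap.mem_ker]
  refine and_congr_right fun hl => ?_
  constructor
  · intro h
    exact dv_of_mem (Submodule.mem_span_singleton_self _) (Submodule.subset_span (Set.mem_range_self 0))
      (Submodule.subset_span (Set.mem_range_self 3)) h
  · intro h3
    have l1 := mem_lineK.1 hl.1
    have l2 := mem_lineK.1 hl.2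
    refine mem_of_dv h hF (by simpa using l1 1 0) ?_
    intro a
    fin_cases a
    · refine dvL_of_line fun c => ?_
      have := l1 (1 + c) 0
      simpa [add_smul] using this
    · exact dvL_of_line fun c => by simpa using l1 1 c
    · exact dvL_of_line fun c => by simpa using l2 1 c
    · exact h3

lemma hdim_eq [Infinite k] {n d : ℕ} {ι κ : Type} (σ : ι → Fin 4 → Fin n → k) (L : κ → Fin 2 → Fin n → k)
    (h : ∀ i, LinearIndependent k (σ i)) :
    hdim k n ((⨅ i, sundialIdeal k n (Submodule.span k {σ i 0, σ i 1}) (Submodule.span k {σ i 0, σ i 2})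
      (Submodule.span k (Set.range (σ i)))) ⊓
        ⨅ j, vanIdeal k n (Submodule.span k {L j 0, L j 1} : Submodule k (Fin n → k))) d
      = Module.finrank k (Rd k n d ⊓ cfgK σ L : Submodule k (MvPolynomial (Fin n) k)) := by
  unfold hdim
  have e : Submodule.restrictScalars k ((⨅ i, sundialIdeal k n (Submodule.span k {σ i 0, σ i 1})
      (Submodule.span k {σ i 0, σ i 2}) (Submodule.span k (Set.range (σ i)))) ⊓
        ⨅ j, vanIdeal k n (Submodule.span k {L j 0, L j 1} : Submodule k (Fin n → k)))
      ⊓ homogeneousSubmodule (Fin n) k d = Rd k n d ⊓ cfgK σ L := by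
    ext F
    rw [Submodule.mem_inf, Submodule.mem_inf, and_comm]
    refine and_congr_right fun hF => ?_
    rw [Submodule.restrictScalars_mem]
    simp only [cfgK, Submodule.mem_inf, Submodule.mem_iInf]
    refine and_congr (forall_congr' fun i => mem_sundial_iff (h i) hF)
      (forall_congr' fun j => mem_van_pair)
  rw [e]

lemma line_of_points [CharZero k] {n d : ℕ} {u v : Fin n → k} {F} (hF : F ∈ Rd k n d)
    (h : ∀ j : Fin (d + 1), eval (u + ((j : ℕ) : k) • v) F = 0) : F ∈ lineK u v := by
  have h0 : lineP u v F = 0 := by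
    refine Polynomial.eq_zero_of_natDegree_lt_card_of_eval_eq_zero (lineP u v F)
      (f := fun j : Fin (d + 1) => ((j : ℕ) : k)) ?_ ?_ ?_
    · intro a b hab
      exact Fin.ext (Nat.cast_injective hab)
    · intro j; rw [eval_lineP]; exact h j
    · rw [Fintype.card_fin, Nat.lt_succ_iff]
      unfold lineP
      refine (aeval_natDegree_le F ((mem_homogeneousSubmodule _ _).1 hF).totalDegree_le (n := 1) _ fun i => ?_).trans (by omega)
      compute_degree
  have h1 : ∀ c : k, eval (u + c • v) F = 0 := fun c => by rw [← eval_lineP, h0]; simp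
  rw [mem_lineK]
  have h2 : ∀ a b : k, a ≠ 0 → eval (a • u + b • v) F = 0 := by
    intro a b ha
    have := eval_smul_hom hF a (u + (b / a) • v)
    rw [h1, smul_add, smul_smul, mul_div_cancel₀ _ ha] at this
    simpa using this
  intro a b
  have h3 : lineP (b • v) u F * Polynomial.X = 0 := Polynomial.funext fun c => by
    rw [Polynomial.eval_mul, eval_lineP, Polynomial.eval_X]
    rcases eq_or_ne c 0 with rfl | hc
    · simp
    · rw [add_comm, h2 c b hc]; simp
  have h4 : lineP (b • v) u F = 0 := by simpa [Polynomial.X_ne_zero] using h3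
  rw [add_comm, ← eval_lineP, h4]; simp

lemma lower_bound [CharZero k] {n d s l : ℕ} (σ : Fin s → Fin 4 → Fin n → k) (L : Fin l → Fin 2 → Fin n → k) :
    Module.finrank k (Rd k n d) ≤
      Module.finrank k (Rd k n d ⊓ cfgK σ L : Submodule k (MvPolynomial (Fin n) k))
      + (2 * s + l) * (d + 1) := by
  let φ : (Fin s × Fin (d + 1)) ⊕ (Fin s × Fin (d + 1)) ⊕ (Fin l × Fin (d + 1)) →
      MvPolynomial (Fin n) k →ₗ[k] k :=
    Sum.elim (fun x => evL (σ x.1 0 + ((x.2 : ℕ) : k) • σ x.1 1))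
      (Sum.elim (fun x => if x.2 = 0 then dvL (σ x.1 0) (σ x.1 3) else
          evL (σ x.1 0 + ((x.2 : ℕ) : k) • σ x.1 2))
        (fun x => evL (L x.1 0 + ((x.2 : ℕ) : k) • L x.1 1)))
  have h1 := finrank_le_add_card (Rd k n d) φ
  have h2 : Fintype.card ((Fin s × Fin (d + 1)) ⊕ (Fin s × Fin (d + 1)) ⊕ (Fin l × Fin (d + 1)))
      = (2 * s + l) * (d + 1) := by
    simp; ring
  rw [h2] at h1
  refine h1.trans (Nat.add_le_add_right (Submodule.finrank_mono ?_) _)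
  rintro F ⟨hF, hF2⟩
  refine ⟨hF, ?_⟩
  simp only [SetLike.mem_coe, Submodule.mem_iInf, LinearMap.mem_ker] at hF2
  have a1 : ∀ i, F ∈ lineK (σ i 0) (σ i 1) := fun i => line_of_points hF fun j => by
    have := hF2 (Sum.inl (i, j))
    simpa [φ, evL_apply] using this
  simp only [cfgK, SetLike.mem_coe, Submodule.mem_inf, Submodule.mem_iInf, sunK, LinearMap.mem_ker]
  refine ⟨fun i => ⟨⟨a1 i, ?_⟩, ?_⟩, fun i => ?_⟩
  · refine line_of_points hF fun j => ?_
    by_cases hj : j = 0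
    · subst hj
      simpa using mem_lineK.1 (a1 i) 1 0
    · have := hF2 (Sum.inr (Sum.inl (i, j)))
      simpa [φ, evL_apply, hj] using this
  · have := hF2 (Sum.inr (Sum.inl (i, 0)))
    simpa [φ] using this
  · refine line_of_points hF fun j => ?_
    have := hF2 (Sum.inr (Sum.inr (i, j)))
    simpa [φ, evL_apply] using this

lemma final [CharZero k] {d τ : ℕ} (hτ : Near d τ) (h2 : 2 * (d - 1) ≤ τ) :
    ∃ (V₁ V₂ T : Fin (d-1) → Submodule k (Fin 5 → k))
      (M : Fin (τ - 2*(d-1)) → Submodule k (Fin 5 → k)),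
      (∀ i, IsSundial k 5 (V₁ i) (V₂ i) (T i)) ∧
      (∀ j, Module.finrank k (M j) = 2) ∧
      hdim k 5 ((⨅ i, sundialIdeal k 5 (V₁ i) (V₂ i) (T i)) ⊓
        ⨅ j, vanIdeal k 5 ↑(M j)) d = (d + 4).choose 4 - τ * (d + 1) := by
  obtain ⟨σ, L, h, hσ, hL⟩ := generic_cfg ((aa (k := k) d).1 τ hτ)
  refine ⟨fun i => Submodule.span k {σ i 0, σ i 1}, fun i => Submodule.span k {σ i 0, σ i 2},
    fun i => Submodule.span k (Set.range (σ i)), fun j => Submodule.span k {L j 0, L j 1},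
    fun i => (sundial_geom (hσ i)).1, fun j => ?_, ?_⟩
  · apply finrank_pair
    convert hL j using 1
    ext i j; fin_cases i <;> rfl
  · rw [hdim_eq σ L hσ]
    have lb := lower_bound (d := d) σ L
    rw [finrank_Rd 4 d, show 2 * (d - 1) + (τ - 2 * (d - 1)) = τ by omega] at lb
    omega
end

theorem stmt13 (k : Type) [Field k] [IsAlgClosed k] [CharZero k]
    (d t ts : ℕ) (hd : 1 ≤ d)
    (ht : t = (d+4).choose 4 / (d+1)) (hts : ts = ((d+4).choose 4 + d) / (d+1)) :
    2*(d-1) ≤ t ∧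
    (∃ (V₁ V₂ T : Fin (d-1) → Submodule k (Fin 5 → k))
      (M : Fin (t - 2*(d-1)) → Submodule k (Fin 5 → k)),
      (∀ i, IsSundial k 5 (V₁ i) (V₂ i) (T i)) ∧
      (∀ j, Module.finrank k (M j) = 2) ∧
      (hdim k 5 ((⨅ i, sundialIdeal k 5 (V₁ i) (V₂ i) (T i)) ⊓
          ⨅ j, vanIdeal k 5 ↑(M j)) d : ℤ)
        = ((d+4).choose 4 : ℤ) - t * (d+1)) ∧
    (∃ (V₁ V₂ T : Fin (d-1) → Submodule k (Fin 5 → k))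
      (M : Fin (ts - 2*(d-1)) → Submodule k (Fin 5 → k)),
      (∀ i, IsSundial k 5 (V₁ i) (V₂ i) (T i)) ∧
      (∀ j, Module.finrank k (M j) = 2) ∧
      hdim k 5 ((⨅ i, sundialIdeal k 5 (V₁ i) (V₂ i) (T i)) ⊓
        ⨅ j, vanIdeal k 5 ↑(M j)) d = 0) := by
  change t = TT d at ht
  change ts = TS d at hts
  subst ht hts
  refine ⟨TT_ge d, ?_, ?_⟩
  · obtain ⟨V₁, V₂, T, M, h1, h2, h3⟩ := final (k := k) (near_TT d) (TT_ge d)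
    refine ⟨V₁, V₂, T, M, h1, h2, ?_⟩
    rw [h3, Nat.cast_sub (TT_le d)]
    push_cast
    rfl
  · obtain ⟨V₁, V₂, T, M, h1, h2, h3⟩ := final (k := k) (near_TS d)
      ((TT_ge d).trans (TT_le_TS d))
    refine ⟨V₁, V₂, T, M, h1, h2, ?_⟩
    rw [h3]
    exact Nat.sub_eq_zero_of_le (TS_ge d)
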